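/- Every flow is weakly S-homotopy equivalent to an S-cofibrant flow: for every flow X there exist an S-cofibrant flow X' and a morphism of flows X' → X which is a weak S-homotopy equivalence. -/

import Mathlib

open CategoryTheory

namespace Gaucher

/-- Helper: any map out of an empty space is continuous. -/
theorem continuous_of_isEmpty {α β : Type*} [TopologicalSpace α] [TopologicalSpace β]
    [IsEmpty α] (f : α → β) : Continuous f :=
  ⟨fun s _ => by rw [Set.eq_empty_of_isEmpty (f ⁻¹' s)]; exact isOpen_empty⟩

/-- Helper: fibers of constant maps are open. -/
theorem isOpen_preimage_const {α β : Type*} [TopologicalSpace α] (b a : β) :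
    IsOpen ((fun _ : α => b) ⁻¹' {a}) := by
  rcases eq_or_ne b a with h | h
  · rw [Set.preimage_const_of_mem (by simpa using h)]; exact isOpen_univ
  · rw [Set.preimage_const_of_notMem (by simpa using h)]; exact isOpen_empty

/-- A flow (Gaucher): a set of states (with the discrete topology), a topological
space of (non-constant) execution paths, source and target maps which are continuous
(i.e. have open fibers, the state set being discrete), and a continuous, associative
partial composition defined on composable pairs of paths. -/
structure Flow : Type 1 where
  /-- the `0`-skeleton, i.e. the set of states -/
  State : Type
  /-- the space of non-constant execution paths -/
  Path : Type
  [topPath : TopologicalSpace Path]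
  /-- source map -/
  s : Path → State
  /-- target map -/
  t : Path → State
  isOpen_preimage_s : ∀ a : State, IsOpen (s ⁻¹' {a})
  isOpen_preimage_t : ∀ a : State, IsOpen (t ⁻¹' {a})
  /-- composition of composable paths -/
  comp : ∀ x y : Path, t x = s y → Path
  continuous_comp : Continuous (fun p : { p : Path × Path // t p.1 = s p.2 } =>
    comp p.1.1 p.1.2 p.2)
  s_comp : ∀ x y h, s (comp x y h) = s x
  t_comp : ∀ x y h, t (comp x y h) = t y
  comp_assoc : ∀ (x y z : Path) (hxy : t x = s y) (hyz : t y = s z)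
    (h₁ : t x = s (comp y z hyz)) (h₂ : t (comp x y hxy) = s z),
    comp x (comp y z hyz) h₁ = comp (comp x y hxy) z h₂

attribute [instance] Flow.topPath

/-- The state set of a flow carries the discrete topology. -/
instance Flow.topState (X : Flow) : TopologicalSpace X.State := ⊥

instance (X : Flow) : DiscreteTopology X.State := ⟨rfl⟩

/-- A morphism of flows: a map preserving states, paths, sources, targets and
composition, continuous on the path spaces (continuity on the discrete state part
being automatic). -/
structure FlowHom (X Y : Flow) : Type where
  toFun0 : X.State → Y.State
  toFunP : X.Path → Y.Path
  continuous_toFunP : Continuous toFunP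
  s_map : ∀ x, Y.s (toFunP x) = toFun0 (X.s x)
  t_map : ∀ x, Y.t (toFunP x) = toFun0 (X.t x)
  comp_map : ∀ x y (h : X.t x = X.s y) (h' : Y.t (toFunP x) = Y.s (toFunP y)),
    toFunP (X.comp x y h) = Y.comp (toFunP x) (toFunP y) h'

theorem FlowHom.ext {X Y : Flow} {f g : FlowHom X Y}
    (h0 : f.toFun0 = g.toFun0) (hP : f.toFunP = g.toFunP) : f = g := by
  cases f; cases g; cases h0; cases hP; rfl

/-- The identity morphism of flows. -/
def FlowHom.id (X : Flow) : FlowHom X X where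
  toFun0 := _root_.id
  toFunP := _root_.id
  continuous_toFunP := continuous_id
  s_map _ := rfl
  t_map _ := rfl
  comp_map _ _ _ _ := rfl

/-- Composition of morphisms of flows (`g.comp f` is `g ∘ f`). -/
def FlowHom.comp {X Y Z : Flow} (g : FlowHom Y Z) (f : FlowHom X Y) : FlowHom X Z where
  toFun0 := g.toFun0 ∘ f.toFun0
  toFunP := g.toFunP ∘ f.toFunP
  continuous_toFunP := g.continuous_toFunP.comp f.continuous_toFunP
  s_map x := by simp only [Function.comp_apply, g.s_map, f.s_map]
  t_map x := by simp only [Function.comp_apply, g.t_map, f.t_map]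
  comp_map x y h h' := by
    have hY : Y.t (f.toFunP x) = Y.s (f.toFunP y) := by
      rw [f.t_map, f.s_map, h]
    show g.toFunP (f.toFunP (X.comp x y h)) = _
    rw [f.comp_map x y h hY, g.comp_map _ _ hY h']
    rfl

/-- The category `Flow` of flows. -/
instance : Category Flow where
  Hom := FlowHom
  id := FlowHom.id
  comp f g := g.comp f
  id_comp f := FlowHom.ext rfl rfl
  comp_id f := FlowHom.ext rfl rfl
  assoc f g h := FlowHom.ext rfl rfl

theorem FlowHom.comp_assoc {W X Y Z : Flow} (h : FlowHom Y Z) (g : FlowHom X Y)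
    (f : FlowHom W X) : (h.comp g).comp f = h.comp (g.comp f) :=
  FlowHom.ext rfl rfl

/-- The flow `Glob Z` associated to a topological space `Z`: two states `0` and `1`,
path space `Z`, every path going from `0` to `1` (no two paths are composable). -/
def Glob (Z : Type) [TopologicalSpace Z] : Flow where
  State := Fin 2
  Path := Z
  s := fun _ => 0
  t := fun _ => 1
  isOpen_preimage_s := fun a => isOpen_preimage_const _ a
  isOpen_preimage_t := fun a => isOpen_preimage_const _ a
  comp := fun _ _ h => absurd (show (1 : Fin 2) = 0 from h) (by decide)
  continuous_comp := by
    haveI : IsEmpty { p : Z × Z // (fun _ : Z => (1 : Fin 2)) p.1 = (fun _ : Z => (0 : Fin 2)) p.2 } :=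
      ⟨fun p => absurd (show (1 : Fin 2) = 0 from p.2) (by decide)⟩
    exact continuous_of_isEmpty _
  s_comp := fun x y h => absurd (show (1 : Fin 2) = 0 from h) (by decide)
  t_comp := fun x y h => absurd (show (1 : Fin 2) = 0 from h) (by decide)
  comp_assoc := fun x y z hxy => absurd (show (1 : Fin 2) = 0 from hxy) (by decide)

/-- Functoriality of `Glob`. -/
def Glob.map {Z W : Type} [TopologicalSpace Z] [TopologicalSpace W] (f : C(Z, W)) :
    FlowHom (Glob Z) (Glob W) where
  toFun0 := _root_.id
  toFunP := f
  continuous_toFunP := f.continuous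
  s_map _ := rfl
  t_map _ := rfl
  comp_map x y h := absurd (show (1 : Fin 2) = 0 from h) (by decide)

/-- The directed segment `I⃗` is `Glob` of a one-point space. -/
def dirSegment : Flow := Glob PUnit

/-- The flow with exactly one state and no non-constant execution path. -/
def pointFlow : Flow where
  State := PUnit
  Path := Empty
  s := fun e => e.elim
  t := fun e => e.elim
  isOpen_preimage_s := fun a => by
    rw [Set.eq_empty_of_isEmpty (_ ⁻¹' {a})]; exact isOpen_empty
  isOpen_preimage_t := fun a => by
    rw [Set.eq_empty_of_isEmpty (_ ⁻¹' {a})]; exact isOpen_empty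
  comp := fun x _ _ => x.elim
  continuous_comp := continuous_of_isEmpty _
  s_comp := fun x => x.elim
  t_comp := fun x => x.elim
  comp_assoc := fun x => x.elim

-- PART B (appended after part A) : S-homotopy, weak homotopy equivalences

/-- Two morphisms of flows `f g : X → Y` are S-homotopic: there is a continuous map
`H : (X⁰ ⊔ ℙX) × [0,1] → Y⁰ ⊔ ℙY` such that every `H(-,u)` is a morphism of flows,
`H(-,0) = f` and `H(-,1) = g`.  (Continuity of `H` on the two summands `ℙX × [0,1]`
and `X⁰ × [0,1]` — the state sets carrying the discrete topology — is exactly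
continuity of the two maps below.) -/
def SHomotopy {X Y : Flow} (f g : FlowHom X Y) : Prop :=
  ∃ F : unitInterval → FlowHom X Y,
    F 0 = f ∧ F 1 = g ∧
    Continuous (fun p : X.Path × unitInterval => (F p.2).toFunP p.1) ∧
    Continuous (fun p : X.State × unitInterval => (F p.2).toFun0 p.1)

/-- A morphism of flows is an S-homotopy equivalence if it admits an inverse up to
S-homotopy. -/
def IsSHomotopyEquiv {X Y : Flow} (f : FlowHom X Y) : Prop :=
  ∃ g : FlowHom Y X, SHomotopy (f.comp g) (FlowHom.id Y) ∧ SHomotopy (g.comp f) (FlowHom.id X)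

/-- Two flows are S-homotopy equivalent. -/
def SHomotopyEquivalent (X Y : Flow) : Prop :=
  ∃ f : FlowHom X Y, IsSHomotopyEquiv f

/-- The underlying continuous map on path spaces of a morphism of flows. -/
def FlowHom.pathMap {X Y : Flow} (f : FlowHom X Y) : C(X.Path, Y.Path) :=
  ⟨f.toFunP, f.continuous_toFunP⟩

/-- The map induced by a continuous map on `π₀` (path components). -/
def pi0Map {A B : Type*} [TopologicalSpace A] [TopologicalSpace B] (h : C(A, B)) :
    ZerothHomotopy A → ZerothHomotopy B :=
  Quotient.map h (fun _ _ j => ⟨j.somePath.map h.continuous⟩)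

/-- Push forward a generalized loop along a continuous map. -/
def GenLoop.push {A B : Type*} [TopologicalSpace A] [TopologicalSpace B] (h : C(A, B))
    {N : Type*} {x : A} (p : GenLoop N A x) : GenLoop N B (h x) :=
  ⟨h.comp p.1, fun y hy => by
    simp only [ContinuousMap.comp_apply]
    exact congrArg h (p.2 y hy)⟩

/-- The map induced by a continuous map on the `N`-th homotopy group. -/
def piMap {A B : Type*} [TopologicalSpace A] [TopologicalSpace B] (h : C(A, B))
    (N : Type*) (x : A) : HomotopyGroup N A x → HomotopyGroup N B (h x) :=
  Quotient.map (GenLoop.push h) (fun _ _ H =>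
    ⟨(Nonempty.some H).compContinuousMap h⟩)

/-- A continuous map is a weak homotopy equivalence: it induces a bijection on path
components and, for every base point and every `n`, a bijection on `πₙ`. -/
def IsWeakHomotopyEquiv {A B : Type*} [TopologicalSpace A] [TopologicalSpace B]
    (h : C(A, B)) : Prop :=
  Function.Bijective (pi0Map h) ∧
    ∀ (x : A) (n : ℕ), Function.Bijective (piMap h (Fin n) x)

/-- A morphism of flows is a weak S-homotopy equivalence if it induces a bijection
on the `0`-skeletons and a weak homotopy equivalence on the path spaces. -/
def IsWeakSHomotopyEquiv {X Y : Flow} (f : FlowHom X Y) : Prop :=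
  Function.Bijective f.toFun0 ∧ IsWeakHomotopyEquiv f.pathMap

-- PART C : S-cofibrant flows

/-- The sphere `S^{n-1}`, boundary of the closed `n`-disk `D^n`. -/
abbrev diskBoundary (n : ℕ) : Type := Metric.sphere (0 : EuclideanSpace ℝ (Fin n)) 1

/-- The closed `n`-disk `D^n`. -/
abbrev closedDisk (n : ℕ) : Type := Metric.closedBall (0 : EuclideanSpace ℝ (Fin n)) 1

/-- The inclusion `S^{n-1} ⊆ D^n`. -/
noncomputable def diskBoundaryInclusion (n : ℕ) : C(diskBoundary n, closedDisk n) :=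
  ⟨fun p => ⟨p.1, Metric.sphere_subset_closedBall p.2⟩,
    Continuous.subtype_mk continuous_subtype_val _⟩

/-- The inclusion of flows `Glob (S^{n-1}) → Glob (D^n)`. -/
noncomputable def globBoundaryInclusion (n : ℕ) : FlowHom (Glob (diskBoundary n)) (Glob (closedDisk n)) :=
  Glob.map (diskBoundaryInclusion n)

/-- A witness that a flow `X` is S-cofibrant: a skeletal filtration `sk 0 → sk 1 → ⋯`
where `sk 0` has empty path space (it is purely a discrete set of states), where
`sk (n+1)` is obtained from `sk n` as the pushout (expressed by its universal property,
`attach_isPushout`) of `⊔ᵢ Glob (S^{n-1}) → ⊔ᵢ Glob (D^n)` along attaching morphisms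
`Glob (S^{n-1}) → sk n` (for `n = 0` this attaches copies of the directed segment
`I⃗ = Glob(D⁰)` along `Glob(S^{-1}) = Glob(∅)`), and where `X` is the colimit
(expressed by its universal property `isColimit`) of the `sk n`. -/
structure SCofibrantStructure (X : Flow) : Type 1 where
  sk : ℕ → Flow
  isEmpty_path_sk_zero : IsEmpty (sk 0).Path
  ι : ∀ n, FlowHom (sk n) (sk (n + 1))
  cells : ℕ → Type
  attachMap : ∀ n, cells n → FlowHom (Glob (diskBoundary n)) (sk n)
  cellMap : ∀ n, cells n → FlowHom (Glob (closedDisk n)) (sk (n + 1))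
  attach_comm : ∀ n (i : cells n),
    (cellMap n i).comp (globBoundaryInclusion n) = (ι n).comp (attachMap n i)
  attach_isPushout : ∀ n (Z : Flow) (g : FlowHom (sk n) Z)
    (k : cells n → FlowHom (Glob (closedDisk n)) Z),
    (∀ i, (k i).comp (globBoundaryInclusion n) = g.comp (attachMap n i)) →
    ∃! h : FlowHom (sk (n + 1)) Z, h.comp (ι n) = g ∧ ∀ i, h.comp (cellMap n i) = k i
  incl : ∀ n, FlowHom (sk n) X
  incl_comm : ∀ n, (incl (n + 1)).comp (ι n) = incl n
  isColimit : ∀ (Z : Flow) (d : ∀ n, FlowHom (sk n) Z),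
    (∀ n, (d (n + 1)).comp (ι n) = d n) →
    ∃! h : FlowHom X Z, ∀ n, h.comp (incl n) = d n

/-- A flow is S-cofibrant if it admits a skeletal filtration as above. -/
def SCofibrant (X : Flow) : Prop :=
  Nonempty (SCofibrantStructure X)

-- PART D : the flow U ⊠ X, S-cofibrations, NDR pairs, the space FLOW(X,Y)

/-- The data exhibiting a flow `B` as a candidate for `U ⊠ X` (`U` a topological
space, `X` a flow): the generators, i.e. the states of `X` and a continuous family
`η (u, x)` of paths indexed by `U × ℙX`, subject to the defining relations
`s(u ⊠ x) = s x`, `t(u ⊠ x) = t x` and `(u ⊠ x) * (u ⊠ y) = u ⊠ (x * y)`. -/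
structure BoxCocone (U : Type) [TopologicalSpace U] (X B : Flow) : Type where
  η0 : X.State → B.State
  η : U × X.Path → B.Path
  continuous_η : Continuous η
  s_η : ∀ u x, B.s (η (u, x)) = η0 (X.s x)
  t_η : ∀ u x, B.t (η (u, x)) = η0 (X.t x)
  comp_η : ∀ u x y (h : X.t x = X.s y) (h' : B.t (η (u, x)) = B.s (η (u, y))),
    B.comp (η (u, x)) (η (u, y)) h' = η (u, X.comp x y h)

/-- `B`, equipped with the data `c`, *is* the flow `U ⊠ X`, i.e. the free flow
generated by `X⁰ ⊔ (U × ℙX)` quotiented by the relations `s (u,x) = s x`,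
`t (u,x) = t x` and `(u,x) * (u,y) = (u, x*y)`: every flow `Z` equipped with such
data receives a unique morphism of flows from `B` compatible with the data. -/
def IsBoxTimes {U : Type} [TopologicalSpace U] {X B : Flow} (c : BoxCocone U X B) : Prop :=
  ∀ (Z : Flow) (d : BoxCocone U X Z),
    ∃! f : FlowHom B Z, f.toFun0 ∘ c.η0 = d.η0 ∧ f.toFunP ∘ c.η = d.η

/-- For `u ∈ U`, the morphism of flows `X → U ⊠ X`, `x ↦ u ⊠ x`. -/
def BoxCocone.atTime {U : Type} [TopologicalSpace U] {X B : Flow}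
    (c : BoxCocone U X B) (u : U) : FlowHom X B where
  toFun0 := c.η0
  toFunP := fun x => c.η (u, x)
  continuous_toFunP := c.continuous_η.comp (Continuous.prodMk_right u)
  s_map x := c.s_η u x
  t_map x := c.t_η u x
  comp_map x y h h' := (c.comp_η u x y h h').symm

/-- Given box-product data `c : BoxCocone U A BUA` and `c' : BoxCocone V X BVX`, a
continuous map `φ : U → V` and a morphism of flows `f : A → X`, this asserts that
`m : BUA → BVX` is the canonically induced morphism `φ ⊠ f`, i.e. `u ⊠ a ↦ φ u ⊠ f a`. -/
def IsInducedBoxHom {U V : Type} [TopologicalSpace U] [TopologicalSpace V]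
    {A X BUA BVX : Flow} (c : BoxCocone U A BUA) (c' : BoxCocone V X BVX)
    (φ : U → V) (f : FlowHom A X) (m : FlowHom BUA BVX) : Prop :=
  (∀ a, m.toFun0 (c.η0 a) = c'.η0 (f.toFun0 a)) ∧
  (∀ u x, m.toFunP (c.η (u, x)) = c'.η (φ u, f.toFunP x))

/-- A morphism of flows `i : A → X` is an S-cofibration if it satisfies the
S-homotopy extension property: for every realization of `[0,1] ⊠ A` and `[0,1] ⊠ X`,
every morphism `g : X → Z` and every S-homotopy `H : [0,1] ⊠ A → Z` starting at
`g ∘ i`, there is an S-homotopy `H̄ : [0,1] ⊠ X → Z` with `H̄(u ⊠ i x) = H(u ⊠ x)`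
and `H̄(0 ⊠ y) = g y`. -/
def IsSCofibration {A X : Flow} (i : FlowHom A X) : Prop :=
  ∀ (IA IX : Flow) (cA : BoxCocone unitInterval A IA) (cX : BoxCocone unitInterval X IX),
    IsBoxTimes cA → IsBoxTimes cX →
    ∀ (Z : Flow) (g : FlowHom X Z) (H : FlowHom IA Z),
      H.comp (cA.atTime 0) = g.comp i →
      ∃ Hbar : FlowHom IX Z,
        (∀ u : unitInterval, (Hbar.comp ((cX.atTime u).comp i)) = H.comp (cA.atTime u)) ∧
        Hbar.comp (cX.atTime 0) = g

/-- `(Y, B)` is an NDR pair: `B` is closed in `Y` and there are `u : Y → [0,1]` with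
`B = u⁻¹(0)` and a homotopy `h : Y × [0,1] → Y` with `h(y,0) = y`, `h(b,t) = b` for
`b ∈ B`, and `h(y,1) ∈ B` as soon as `u y < 1`. -/
def IsNDRPair {Y : Type} [TopologicalSpace Y] (B : Set Y) : Prop :=
  IsClosed B ∧ ∃ (u : C(Y, unitInterval)) (h : C(Y × unitInterval, Y)),
    B = {y | u y = 0} ∧
    (∀ y, h (y, 0) = y) ∧
    (∀ b ∈ B, ∀ t, h (b, t) = b) ∧
    (∀ y, (u y : ℝ) < 1 → h (y, 1) ∈ B)

/-- `(Y, B)` is a DR pair: as for an NDR pair, but with `u y < 1` everywhere, so that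
`B` is a deformation retract of `Y`. -/
def IsDRPair {Y : Type} [TopologicalSpace Y] (B : Set Y) : Prop :=
  IsClosed B ∧ ∃ (u : C(Y, unitInterval)) (h : C(Y × unitInterval, Y)),
    B = {y | u y = 0} ∧
    (∀ y, h (y, 0) = y) ∧
    (∀ b ∈ B, ∀ t, h (b, t) = b) ∧
    (∀ y, (u y : ℝ) < 1 → h (y, 1) ∈ B) ∧
    (∀ y, (u y : ℝ) < 1)

/-- A morphism of flows, as a continuous map `X⁰ ⊔ ℙX → Y⁰ ⊔ ℙY`. -/
def FlowHom.toSumMap {X Y : Flow} (f : FlowHom X Y) :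
    C(X.State ⊕ X.Path, Y.State ⊕ Y.Path) :=
  ⟨Sum.map f.toFun0 f.toFunP,
    (continuous_of_discreteTopology (α := X.State)).sumMap f.continuous_toFunP⟩

/-- The set of morphisms of flows from `X` to `Y` carries the topology induced, via
`FlowHom.toSumMap`, by the compact-open topology. -/
def flowHomInducedTop (X Y : Flow) : TopologicalSpace (FlowHom X Y) :=
  TopologicalSpace.induced FlowHom.toSumMap ContinuousMap.compactOpen

/-- The space `FLOW(X,Y)`: morphisms of flows with the Kelleyfication of the induced
compact-open topology. -/
instance FlowHom.topologicalSpace (X Y : Flow) : TopologicalSpace (FlowHom X Y) :=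
  @TopologicalSpace.compactlyGenerated.{0} (FlowHom X Y) (flowHomInducedTop X Y)

-- PART E : model structures, localization, limits machinery

/-- The class of weak S-homotopy equivalences, as a class of morphisms of the
category `Flow`. -/
def weakSHomotopyEquivalences : MorphismProperty Flow :=
  fun _ _ f => IsWeakSHomotopyEquiv f

/-- `f` is a retract of `g` in the arrow category. -/
def IsRetractOfHom {C : Type*} [Category C] {X Y Z W : C} (f : X ⟶ Y) (g : Z ⟶ W) : Prop :=
  ∃ (i : X ⟶ Z) (r : Z ⟶ X) (i' : Y ⟶ W) (r' : W ⟶ Y),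
    i ≫ r = 𝟙 X ∧ i' ≫ r' = 𝟙 Y ∧ i ≫ g = f ≫ i' ∧ g ≫ r' = r ≫ f

/-- A model category structure (Quillen) on a category `C`: three classes of
morphisms — weak equivalences, cofibrations and fibrations — satisfying
two-out-of-three, stability under retracts, the lifting axioms and the
factorization axioms. -/
structure ModelStructure (C : Type*) [Category C] where
  weq : MorphismProperty C
  cof : MorphismProperty C
  fib : MorphismProperty C
  weq_two_out_of_three : weq.HasTwoOutOfThreeProperty
  weq_retract : ∀ {X Y Z W : C} (f : X ⟶ Y) (g : Z ⟶ W),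
    IsRetractOfHom f g → weq g → weq f
  cof_retract : ∀ {X Y Z W : C} (f : X ⟶ Y) (g : Z ⟶ W),
    IsRetractOfHom f g → cof g → cof f
  fib_retract : ∀ {X Y Z W : C} (f : X ⟶ Y) (g : Z ⟶ W),
    IsRetractOfHom f g → fib g → fib f
  lift_cof_trivFib : ∀ {A B P Q : C} (i : A ⟶ B) (p : P ⟶ Q),
    cof i → fib p → weq p → HasLiftingProperty i p
  lift_trivCof_fib : ∀ {A B P Q : C} (i : A ⟶ B) (p : P ⟶ Q),
    cof i → weq i → fib p → HasLiftingProperty i p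
  fact_cof_trivFib : ∀ {X Y : C} (f : X ⟶ Y),
    ∃ (Z : C) (i : X ⟶ Z) (p : Z ⟶ Y), cof i ∧ fib p ∧ weq p ∧ i ≫ p = f
  fact_trivCof_fib : ∀ {X Y : C} (f : X ⟶ Y),
    ∃ (Z : C) (i : X ⟶ Z) (p : Z ⟶ Y), cof i ∧ weq i ∧ fib p ∧ i ≫ p = f

/-- The S-homotopy relation, as a relation on the morphisms of the full subcategory
of S-cofibrant flows. -/
def sHomotopyHomRel : HomRel (ObjectProperty.FullSubcategory SCofibrant) :=
  fun {_ _} f g => SHomotopy f.hom g.hom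

/-- The canonical map `FLOW(X, lim Yⱼ) → lim FLOW(X, Yⱼ)`, the target being realized
as the subspace of the product `Π j, FLOW(X, Yⱼ)` consisting of the compatible
families. -/
def canonicalMapToLimit (X : Flow) {J : Type} [SmallCategory J] (D : J ⥤ Flow)
    (c : Limits.Cone D) :
    FlowHom X c.pt →
      {p : ∀ j, FlowHom X (D.obj j) // ∀ ⦃j j' : J⦄ (φ : j ⟶ j'),
        (D.map φ).comp (p j) = p j'} :=
  fun g => ⟨fun j => (c.π.app j).comp g, by
    intro j j' φ
    have h := c.π.naturality φ
    have h2 : FlowHom.comp (D.map φ) (c.π.app j) = c.π.app j' := by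
      have h3 := h.symm.trans
        (show ((Functor.const J).obj c.pt).map φ ≫ c.π.app j' = c.π.app j' from
          FlowHom.ext rfl rfl)
      exact h3
    show FlowHom.comp (D.map φ) (FlowHom.comp (c.π.app j) g) = FlowHom.comp (c.π.app j') g
    rw [← FlowHom.comp_assoc, h2]⟩


section
/-- A presentation of a flow by generators and an impredicative class of admissible cocones. -/
structure Pres : Type 1 where
  S : Type
  G : Type
  src : G → S
  tgt : G → S
  adm : ∀ Z : Flow, (S → Z.State) → (G → Z.Path) → Prop
  adm_s : ∀ (Z : Flow) (z0 : S → Z.State) (zP : G → Z.Path), adm Z z0 zP →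
    ∀ g, Z.s (zP g) = z0 (src g)
  adm_t : ∀ (Z : Flow) (z0 : S → Z.State) (zP : G → Z.Path), adm Z z0 zP →
    ∀ g, Z.t (zP g) = z0 (tgt g)

namespace Pres

variable (P : Pres)

/-- formal composites -/
inductive Term : P.S → P.S → Type
  | gen (g : P.G) : Term (P.src g) (P.tgt g)
  | comp {a b c : P.S} : Term a b → Term b c → Term a c

/-- an admissible cocone -/
structure Coc (Z : Flow) where
  z0 : P.S → Z.State
  zP : P.G → Z.Path
  adm : P.adm Z z0 zP

variable {P}

/-- evaluation of a formal composite -/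
def Coc.eval {Z : Flow} (c : P.Coc Z) : ∀ {a b : P.S}, P.Term a b →
    {x : Z.Path // Z.s x = c.z0 a ∧ Z.t x = c.z0 b}
  | _, _, .gen g => ⟨c.zP g, P.adm_s Z _ _ c.adm g, P.adm_t Z _ _ c.adm g⟩
  | _, _, .comp u v => ⟨Z.comp (c.eval u).1 (c.eval v).1
      ((c.eval u).2.2.trans (c.eval v).2.1.symm), by
        rw [Z.s_comp]; exact (c.eval u).2.1, by rw [Z.t_comp]; exact (c.eval v).2.2⟩

variable (P)

/-- formal composites with their end points -/
abbrev Raw : Type := Σ a b : P.S, P.Term a b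

/-- two formal composites are identified when no admissible cocone separates them -/
def setoid : Setoid P.Raw where
  r x y := x.1 = y.1 ∧ x.2.1 = y.2.1 ∧
    ∀ (Z : Flow) (c : P.Coc Z), (c.eval x.2.2).1 = (c.eval y.2.2).1
  iseqv := ⟨fun _ => ⟨rfl, rfl, fun _ _ => rfl⟩,
    fun h => ⟨h.1.symm, h.2.1.symm, fun Z c => (h.2.2 Z c).symm⟩,
    fun h h' => ⟨h.1.trans h'.1, h.2.1.trans h'.2.1,
      fun Z c => (h.2.2 Z c).trans (h'.2.2 Z c)⟩⟩

/-- the path set of the presented flow -/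
def QPath : Type := Quotient P.setoid

variable {P}

/-- source -/
def qs : P.QPath → P.S := Quotient.lift (fun x => x.1) (fun _ _ h => h.1)
/-- target -/
def qt : P.QPath → P.S := Quotient.lift (fun x => x.2.1) (fun _ _ h => h.2.1)
/-- evaluation on classes -/
def Coc.evalQ {Z : Flow} (c : P.Coc Z) : P.QPath → Z.Path :=
  Quotient.lift (fun x => (c.eval x.2.2).1) (fun _ _ h => h.2.2 Z c)

theorem Coc.s_evalQ {Z : Flow} (c : P.Coc Z) (x : P.QPath) : Z.s (c.evalQ x) = c.z0 (qs x) := by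
  induction x using Quotient.inductionOn with
  | h x => exact (c.eval x.2.2).2.1

theorem Coc.t_evalQ {Z : Flow} (c : P.Coc Z) (x : P.QPath) : Z.t (c.evalQ x) = c.z0 (qt x) := by
  induction x using Quotient.inductionOn with
  | h x => exact (c.eval x.2.2).2.2

theorem qext {x y : P.QPath} (hs : qs x = qs y) (ht : qt x = qt y)
    (h : ∀ (Z : Flow) (c : P.Coc Z), c.evalQ x = c.evalQ y) : x = y := by
  induction x using Quotient.inductionOn with
  | h x =>
    induction y using Quotient.inductionOn with
    | h y => exact Quotient.sound ⟨hs, ht, h⟩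

open Classical in
/-- total composition of raw composites -/
noncomputable def rawComp (p q : P.Raw) : P.Raw :=
  if h : p.2.1 = q.1 then ⟨p.1, q.2.1, .comp p.2.2 (cast (congrArg (fun a => P.Term a q.2.1) h.symm) q.2.2)⟩ else p

theorem rawComp_spec (p q : P.Raw) (h : p.2.1 = q.1) :
    (rawComp p q).1 = p.1 ∧ (rawComp p q).2.1 = q.2.1 ∧
    ∀ (Z : Flow) (c : P.Coc Z) (h' : Z.t (c.eval p.2.2).1 = Z.s (c.eval q.2.2).1),
      (c.eval (rawComp p q).2.2).1 = Z.comp (c.eval p.2.2).1 (c.eval q.2.2).1 h' := by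
  obtain ⟨a, b, u⟩ := p
  obtain ⟨b', d, v⟩ := q
  dsimp at h
  subst h
  have e : rawComp (⟨a, b, u⟩ : P.Raw) ⟨b, d, v⟩ = ⟨a, d, .comp u v⟩ := by
    unfold rawComp
    exact dif_pos rfl
  rw [e]
  exact ⟨rfl, rfl, fun Z c h' => rfl⟩

/-- composition of classes -/
noncomputable def qcomp (x y : P.QPath) : P.QPath :=
  Quotient.map₂ rawComp (by
    rintro p p' hp q q' hq
    by_cases h : p.2.1 = q.1
    · have h' : p'.2.1 = q'.1 := by rw [← hp.2.1, h, hq.1]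
      obtain ⟨e1, e2, e3⟩ := rawComp_spec p q h
      obtain ⟨f1, f2, f3⟩ := rawComp_spec p' q' h'
      refine ⟨by rw [e1, f1, hp.1], by rw [e2, f2, hq.2.1], fun Z c => ?_⟩
      have k : Z.t (c.eval p.2.2).1 = Z.s (c.eval q.2.2).1 := by
        rw [(c.eval p.2.2).2.2, (c.eval q.2.2).2.1, h]
      have k' : Z.t (c.eval p'.2.2).1 = Z.s (c.eval q'.2.2).1 := by
        rw [(c.eval p'.2.2).2.2, (c.eval q'.2.2).2.1, h']
      rw [e3 Z c k, f3 Z c k']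
      congr 1
      · exact hp.2.2 Z c
      · exact hq.2.2 Z c
    · have h' : ¬ p'.2.1 = q'.1 := by rw [← hp.2.1, ← hq.1]; exact h
      simp only [rawComp, dif_neg h, dif_neg h']
      exact hp) x y

theorem qcomp_spec (x y : P.QPath) (h : qt x = qs y) :
    qs (qcomp x y) = qs x ∧ qt (qcomp x y) = qt y ∧
    ∀ (Z : Flow) (c : P.Coc Z) (h' : Z.t (c.evalQ x) = Z.s (c.evalQ y)),
      c.evalQ (qcomp x y) = Z.comp (c.evalQ x) (c.evalQ y) h' := by
  induction x using Quotient.inductionOn with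
  | h x =>
    induction y using Quotient.inductionOn with
    | h y => exact rawComp_spec x y h

theorem Coc.evalQ_ht {Z : Flow} (c : P.Coc Z) {x y : P.QPath} (h : qt x = qs y) :
    Z.t (c.evalQ x) = Z.s (c.evalQ y) := by
  rw [c.t_evalQ, c.s_evalQ, h]

/-- topology on the path set -/
instance qtop : TopologicalSpace P.QPath :=
  (TopologicalSpace.induced (fun p => (qs p, qt p)) ⊥) ⊓
    ⨅ (Z : Flow) (c : P.Coc Z), TopologicalSpace.induced c.evalQ Z.topPath

theorem Coc.continuous_evalQ {Z : Flow} (c : P.Coc Z) : Continuous (c.evalQ) := by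
  have : (qtop : TopologicalSpace P.QPath) ≤ TopologicalSpace.induced c.evalQ Z.topPath :=
    inf_le_right.trans ((iInf_le _ Z).trans (iInf_le _ c))
  exact continuous_iff_le_induced.2 this

theorem continuous_to_q {A : Type*} [TopologicalSpace A] (f : A → P.QPath)
    (h0 : ∀ a b, IsOpen {x | qs (f x) = a ∧ qt (f x) = b})
    (h : ∀ (Z : Flow) (c : P.Coc Z), Continuous (fun x => c.evalQ (f x))) : Continuous f := by
  refine continuous_iff_coinduced_le.2 (le_inf ?_ (le_iInf fun Z => le_iInf fun c =>
    continuous_iff_coinduced_le.1 (continuous_induced_rng.2 (h Z c))))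
  · refine continuous_iff_coinduced_le.1 (continuous_induced_rng.2 ?_)
    letI : TopologicalSpace (P.S × P.S) := ⊥
    haveI : DiscreteTopology (P.S × P.S) := ⟨rfl⟩
    refine continuous_discrete_rng.2 ?_
    rintro ⟨a, b⟩
    convert h0 a b using 1
    ext x; simp [Prod.ext_iff]

theorem isOpen_q (a b : P.S) : IsOpen {x : P.QPath | qs x = a ∧ qt x = b} := by
  have : (qtop : TopologicalSpace P.QPath) ≤ TopologicalSpace.induced (fun p => (qs p, qt p)) ⊥ :=
    inf_le_left
  refine this _ ?_
  refine ⟨{(a, b)}, ?_, ?_⟩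
  · trivial
  · ext x; simp [Prod.ext_iff]

theorem isOpen_qs (a : P.S) : IsOpen (qs ⁻¹' {a} : Set P.QPath) := by
  have : (qs ⁻¹' {a} : Set P.QPath) = ⋃ b, {x : P.QPath | qs x = a ∧ qt x = b} := by
    ext x; simp
  rw [this]; exact isOpen_iUnion fun b => isOpen_q a b

theorem isOpen_qt (a : P.S) : IsOpen (qt ⁻¹' {a} : Set P.QPath) := by
  have : (qt ⁻¹' {a} : Set P.QPath) = ⋃ b, {x : P.QPath | qs x = b ∧ qt x = a} := by
    ext x; simp
  rw [this]; exact isOpen_iUnion fun b => isOpen_q b a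

variable (P)

/-- the presented flow -/
noncomputable def U : Flow where
  State := P.S
  Path := P.QPath
  s := qs
  t := qt
  isOpen_preimage_s := isOpen_qs
  isOpen_preimage_t := isOpen_qt
  comp x y _ := qcomp x y
  continuous_comp := by
    refine continuous_to_q _ ?_ ?_
    · intro a b
      have : {x : { p : P.QPath × P.QPath // qt p.1 = qs p.2 } |
          qs (qcomp x.1.1 x.1.2) = a ∧ qt (qcomp x.1.1 x.1.2) = b} =
          {x | qs x.1.1 = a} ∩ {x | qt x.1.2 = b} := by
        ext x
        simp only [Set.mem_ofPred_eq, Set.mem_inter_iff, (qcomp_spec _ _ x.2).1,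
          (qcomp_spec _ _ x.2).2.1]
      rw [this]
      exact ((isOpen_qs a).preimage (continuous_fst.comp continuous_subtype_val)).inter
        ((isOpen_qt b).preimage (continuous_snd.comp continuous_subtype_val))
    · intro Z c
      have : (fun x : { p : P.QPath × P.QPath // qt p.1 = qs p.2 } =>
          c.evalQ (qcomp x.1.1 x.1.2)) = (fun p : { p : Z.Path × Z.Path // Z.t p.1 = Z.s p.2 } =>
            Z.comp p.1.1 p.1.2 p.2) ∘ (fun x => ⟨(c.evalQ x.1.1, c.evalQ x.1.2),
              c.evalQ_ht x.2⟩) := by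
        funext x
        exact (qcomp_spec _ _ x.2).2.2 Z c _
      rw [this]
      refine Z.continuous_comp.comp (Continuous.subtype_mk ?_ _)
      exact (c.continuous_evalQ.comp (continuous_fst.comp continuous_subtype_val)).prodMk
        (c.continuous_evalQ.comp (continuous_snd.comp continuous_subtype_val))
  s_comp x y h := (qcomp_spec x y h).1
  t_comp x y h := (qcomp_spec x y h).2.1
  comp_assoc x y z hxy hyz h₁ h₂ := by
    refine qext ?_ ?_ ?_
    · rw [(qcomp_spec _ _ h₁).1, (qcomp_spec _ _ h₂).1, (qcomp_spec _ _ hxy).1]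
    · rw [(qcomp_spec _ _ h₁).2.1, (qcomp_spec _ _ h₂).2.1, (qcomp_spec _ _ hyz).2.1]
    · intro Z c
      rw [(qcomp_spec _ _ h₁).2.2 Z c (c.evalQ_ht h₁), (qcomp_spec _ _ h₂).2.2 Z c (c.evalQ_ht h₂)]
      simp only [(qcomp_spec _ _ hxy).2.2 Z c (c.evalQ_ht hxy),
        (qcomp_spec _ _ hyz).2.2 Z c (c.evalQ_ht hyz)]
      exact Z.comp_assoc _ _ _ _ _ _ _

/-- generators -/
def gen (g : P.G) : P.U.Path := Quotient.mk P.setoid ⟨P.src g, P.tgt g, .gen g⟩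

theorem s_gen (g : P.G) : P.U.s (P.gen g) = P.src g := rfl
theorem t_gen (g : P.G) : P.U.t (P.gen g) = P.tgt g := rfl

variable {P}

/-- the morphism induced by an admissible cocone -/
noncomputable def Coc.lift {Z : Flow} (c : P.Coc Z) : FlowHom P.U Z where
  toFun0 := c.z0
  toFunP := c.evalQ
  continuous_toFunP := c.continuous_evalQ
  s_map := c.s_evalQ
  t_map := c.t_evalQ
  comp_map x y h h' := (qcomp_spec x y h).2.2 Z c h'

theorem Coc.lift_gen {Z : Flow} (c : P.Coc Z) (g : P.G) : c.lift.toFunP (P.gen g) = c.zP g := rfl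

theorem U_ind {motive : P.U.Path → Prop} (hg : ∀ g, motive (P.gen g))
    (hc : ∀ (x y : P.U.Path) (h : P.U.t x = P.U.s y), motive x → motive y →
      motive (P.U.comp x y h)) (x : P.U.Path) : motive x := by
  induction x using Quotient.inductionOn with
  | h x =>
    obtain ⟨a, b, u⟩ := x
    induction u with
    | gen g => exact hg g
    | @comp a b d u v hu hv =>
      have := hc (Quotient.mk P.setoid ⟨a, b, u⟩) (Quotient.mk P.setoid ⟨b, d, v⟩) rfl hu hv
      refine cast ?_ this
      congr 1
      refine Quotient.sound ?_
      obtain ⟨e1, e2, e3⟩ := rawComp_spec (⟨a, b, u⟩ : P.Raw) ⟨b, d, v⟩ rfl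
      exact ⟨e1, e2, fun Z c => e3 Z c _⟩

theorem U_hom_ext {Z : Flow} {f g : FlowHom P.U Z} (h0 : f.toFun0 = g.toFun0)
    (h : ∀ x, f.toFunP (P.gen x) = g.toFunP (P.gen x)) : f = g := by
  refine FlowHom.ext h0 (funext fun x => ?_)
  induction x using U_ind with
  | hg x => exact h x
  | hc x y hxy ihx ihy =>
    rw [f.comp_map x y hxy (by rw [f.t_map, f.s_map, hxy]),
      g.comp_map x y hxy (by rw [g.t_map, g.s_map, hxy])]
    congr 1

theorem U_ext {x y : P.U.Path} (hs : P.U.s x = P.U.s y) (ht : P.U.t x = P.U.t y)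
    (h : ∀ (Z : Flow) (c : P.Coc Z), c.lift.toFunP x = c.lift.toFunP y) : x = y :=
  qext hs ht h

theorem continuous_to_U {A : Type*} [TopologicalSpace A] (f : A → P.U.Path)
    (h0 : ∀ a b, IsOpen {x | P.U.s (f x) = a ∧ P.U.t (f x) = b})
    (h : ∀ (Z : Flow) (c : P.Coc Z), Continuous (fun x => c.lift.toFunP (f x))) : Continuous f :=
  continuous_to_q f h0 h

end Pres

end

section
theorem FlowHom.ht {X Y : Flow} (f : FlowHom X Y) {x y : X.Path} (h : X.t x = X.s y) :
    Y.t (f.toFunP x) = Y.s (f.toFunP y) := by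
  rw [f.t_map, f.s_map, h]

theorem FlowHom.congrP {X Y : Flow} {f g : FlowHom X Y} (h : f = g) (x : X.Path) :
    f.toFunP x = g.toFunP x := by rw [h]

theorem FlowHom.congr0 {X Y : Flow} {f g : FlowHom X Y} (h : f = g) (x : X.State) :
    f.toFun0 x = g.toFun0 x := by rw [h]

theorem Flow.comp_congr (X : Flow) {x y x' y' : X.Path} (hx : x = x') (hy : y = y')
    (h : X.t x = X.s y) (h' : X.t x' = X.s y') : X.comp x y h = X.comp x' y' h' := by
  subst hx; subst hy; rfl

/-- morphisms out of a globe -/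
def globHom {D : Type} [TopologicalSpace D] {Z : Flow} (α β : Z.State) (f : C(D, Z.Path))
    (hs : ∀ c, Z.s (f c) = α) (ht : ∀ c, Z.t (f c) = β) : FlowHom (Glob D) Z where
  toFun0 := ![α, β]
  toFunP := f
  continuous_toFunP := f.continuous
  s_map x := hs x
  t_map x := ht x
  comp_map x y h := absurd (show (1 : Fin 2) = 0 from h) (by decide)

/-- source state of a globe -/
abbrev gs (D : Type) [TopologicalSpace D] : (Glob D).State := (0 : Fin 2)
/-- target state of a globe -/
abbrev gt (D : Type) [TopologicalSpace D] : (Glob D).State := (1 : Fin 2)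

theorem globHom_ext {D : Type} [TopologicalSpace D] {Z : Flow} {f g : FlowHom (Glob D) Z}
    (h0 : f.toFun0 (gs D) = g.toFun0 (gs D)) (h1 : f.toFun0 (gt D) = g.toFun0 (gt D))
    (h : ∀ c, f.toFunP c = g.toFunP c) : f = g := by
  refine FlowHom.ext (funext fun i => ?_) (funext h)
  obtain h | h : i = gs D ∨ i = gt D := by
    have : ∀ i : Fin 2, i = 0 ∨ i = 1 := by decide
    exact this i
  · rw [h, h0]
  · rw [h, h1]

section attach

variable {Y : Flow} {n : ℕ} {J : Type} (a : J → FlowHom (Glob (diskBoundary n)) Y)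

/-- presentation of the pushout -/
def attPres : Pres where
  S := Y.State
  G := Y.Path ⊕ (J × closedDisk n)
  src := Sum.elim Y.s (fun p => (a p.1).toFun0 (gs _))
  tgt := Sum.elim Y.t (fun p => (a p.1).toFun0 (gt _))
  adm Z z0 zP := ∃ (g : FlowHom Y Z) (k : J → FlowHom (Glob (closedDisk n)) Z),
    g.toFun0 = z0 ∧ (∀ y, g.toFunP y = zP (Sum.inl y)) ∧
    (∀ j c, (k j).toFunP c = zP (Sum.inr (j, c))) ∧
    ∀ j, (k j).comp (globBoundaryInclusion n) = g.comp (a j)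
  adm_s := by
    rintro Z z0 zP ⟨g, k, rfl, h1, h2, h3⟩ (y | ⟨j, c⟩)
    · rw [← h1]; exact g.s_map y
    · refine (congrArg Z.s (h2 j c)).symm.trans (((k j).s_map c).trans ?_); exact FlowHom.congr0 (h3 j) (gs _)
  adm_t := by
    rintro Z z0 zP ⟨g, k, rfl, h1, h2, h3⟩ (y | ⟨j, c⟩)
    · rw [← h1]; exact g.t_map y
    · refine (congrArg Z.t (h2 j c)).symm.trans (((k j).t_map c).trans ?_); exact FlowHom.congr0 (h3 j) (gt _)

/-- the pushout -/
noncomputable def Attach : Flow := (attPres a).U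

/-- inclusion of the base in the pushout -/
noncomputable def attι : FlowHom Y (Attach a) where
  toFun0 x := x
  toFunP y := (attPres a).gen (Sum.inl y)
  continuous_toFunP := by
    refine Pres.continuous_to_U _ ?_ ?_
    · intro p q
      exact (Y.isOpen_preimage_s p).inter (Y.isOpen_preimage_t q)
    · rintro Z ⟨z0, zP, hc⟩
      obtain ⟨g, k, h0, h1, h2, h3⟩ := id hc
      exact g.continuous_toFunP.congr h1
  s_map y := rfl
  t_map y := rfl
  comp_map x y h h' := by
    refine Pres.U_ext ?_ ?_ ?_
    · exact (Y.s_comp x y h).trans ((attPres a).U.s_comp _ _ h').symm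
    · exact (Y.t_comp x y h).trans ((attPres a).U.t_comp _ _ h').symm
    · rintro Z ⟨z0, zP, hc⟩
      obtain ⟨g, k, h0, h1, h2, h3⟩ := id hc
      refine Eq.trans ?_ (FlowHom.comp_map _ _ _ h' (FlowHom.ht _ h')).symm
      refine (h1 _).symm.trans ((g.comp_map x y h (g.ht h)).trans ?_)
      exact Z.comp_congr (h1 x) (h1 y) _ _

/-- the cells of the pushout -/
noncomputable def attCell (j : J) : FlowHom (Glob (closedDisk n)) (Attach a) where
  toFun0 := (a j).toFun0
  toFunP c := (attPres a).gen (Sum.inr (j, c))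
  continuous_toFunP := by
    refine Pres.continuous_to_U _ ?_ ?_
    · intro p q
      by_cases h : (a j).toFun0 (gs _) = p ∧ (a j).toFun0 (gt _) = q
      · convert isOpen_univ
        exact Set.eq_univ_of_forall fun _ => h
      · convert isOpen_empty
        exact Set.eq_empty_of_forall_notMem fun _ => h
    · rintro Z ⟨z0, zP, hc⟩
      obtain ⟨g, k, h0, h1, h2, h3⟩ := id hc
      exact (k j).continuous_toFunP.congr (h2 j)
  s_map y := rfl
  t_map y := rfl
  comp_map x y h := absurd (show (1 : Fin 2) = 0 from h) (by decide)

theorem att_comm (j : J) : (attCell a j).comp (globBoundaryInclusion n) = (attι a).comp (a j) := by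
  refine FlowHom.ext rfl (funext fun c => ?_)
  refine Pres.U_ext ?_ ?_ ?_
  · exact ((a j).s_map c).symm
  · exact ((a j).t_map c).symm
  · rintro Z ⟨z0, zP, hc⟩
    obtain ⟨g, k, h0, h1, h2, h3⟩ := id hc
    exact (h2 j _).symm.trans ((FlowHom.congrP (h3 j) c).trans (h1 _))

theorem att_comm_apply (j : J) (c : diskBoundary n) :
    (attCell a j).toFunP (diskBoundaryInclusion n c) = (attι a).toFunP ((a j).toFunP c) :=
  FlowHom.congrP (att_comm a j) c

variable {a}

/-- universal property of the pushout -/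
noncomputable def attDesc {Z : Flow} (g : FlowHom Y Z) (k : J → FlowHom (Glob (closedDisk n)) Z)
    (h : ∀ j, (k j).comp (globBoundaryInclusion n) = g.comp (a j)) : FlowHom (Attach a) Z :=
  Pres.Coc.lift (P := attPres a) ⟨g.toFun0, Sum.elim g.toFunP (fun p => (k p.1).toFunP p.2),
    g, k, rfl, fun _ => rfl, fun _ _ => rfl, h⟩

theorem attDesc_toFun0 {Z : Flow} (g : FlowHom Y Z) (k : J → FlowHom (Glob (closedDisk n)) Z)
    (h : ∀ j, (k j).comp (globBoundaryInclusion n) = g.comp (a j)) :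
    (attDesc g k h).toFun0 = g.toFun0 := rfl

theorem attDesc_ι {Z : Flow} (g : FlowHom Y Z) (k : J → FlowHom (Glob (closedDisk n)) Z)
    (h : ∀ j, (k j).comp (globBoundaryInclusion n) = g.comp (a j)) :
    (attDesc g k h).comp (attι a) = g := FlowHom.ext rfl rfl

theorem attDesc_ι_apply {Z : Flow} (g : FlowHom Y Z) (k : J → FlowHom (Glob (closedDisk n)) Z)
    (h : ∀ j, (k j).comp (globBoundaryInclusion n) = g.comp (a j)) (y : Y.Path) :
    (attDesc g k h).toFunP ((attι a).toFunP y) = g.toFunP y := rfl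

theorem attDesc_cell {Z : Flow} (g : FlowHom Y Z) (k : J → FlowHom (Glob (closedDisk n)) Z)
    (h : ∀ j, (k j).comp (globBoundaryInclusion n) = g.comp (a j)) (j : J) :
    (attDesc g k h).comp (attCell a j) = k j :=
  have h0 : (k j).toFun0 = g.toFun0 ∘ (a j).toFun0 := funext fun x => FlowHom.congr0 (h j) x
  FlowHom.ext h0.symm rfl

theorem attDesc_cell_apply {Z : Flow} (g : FlowHom Y Z) (k : J → FlowHom (Glob (closedDisk n)) Z)
    (h : ∀ j, (k j).comp (globBoundaryInclusion n) = g.comp (a j)) (j : J) (c : closedDisk n) :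
    (attDesc g k h).toFunP ((attCell a j).toFunP c) = (k j).toFunP c := rfl

theorem att_ind {motive : (Attach a).Path → Prop} (hι : ∀ y, motive ((attι a).toFunP y))
    (hcell : ∀ j c, motive ((attCell a j).toFunP c))
    (hc : ∀ (x y : (Attach a).Path) (h : (Attach a).t x = (Attach a).s y), motive x → motive y →
      motive ((Attach a).comp x y h)) (x : (Attach a).Path) : motive x := by
  refine Pres.U_ind ?_ hc x
  rintro (y | ⟨j, c⟩)
  · exact hι y
  · exact hcell j c

theorem att_hom_ext {Z : Flow} {f g : FlowHom (Attach a) Z}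
    (h : f.comp (attι a) = g.comp (attι a))
    (h' : ∀ j, f.comp (attCell a j) = g.comp (attCell a j)) : f = g := by
  refine Pres.U_hom_ext (funext fun x => FlowHom.congr0 h x) ?_
  rintro (y | ⟨j, c⟩)
  · exact FlowHom.congrP h y
  · exact FlowHom.congrP (h' j) c

variable (a)

theorem att_isPushout (Z : Flow) (g : FlowHom Y Z) (k : J → FlowHom (Glob (closedDisk n)) Z)
    (h : ∀ j, (k j).comp (globBoundaryInclusion n) = g.comp (a j)) :
    ∃! f : FlowHom (Attach a) Z, f.comp (attι a) = g ∧ ∀ j, f.comp (attCell a j) = k j := by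
  refine ⟨attDesc g k h, ⟨attDesc_ι g k h, attDesc_cell g k h⟩, ?_⟩
  rintro f ⟨h1, h2⟩
  refine att_hom_ext ?_ ?_
  · rw [h1, attDesc_ι]
  · intro j; rw [h2, attDesc_cell]

end attach

end

section
/-- a flow without paths -/
def discFlow (S : Type) : Flow where
  State := S
  Path := Empty
  s := fun e => e.elim
  t := fun e => e.elim
  isOpen_preimage_s := fun a => by
    rw [Set.eq_empty_of_isEmpty (_ ⁻¹' {a})]; exact isOpen_empty
  isOpen_preimage_t := fun a => by
    rw [Set.eq_empty_of_isEmpty (_ ⁻¹' {a})]; exact isOpen_empty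
  comp := fun x _ _ => x.elim
  continuous_comp := continuous_of_isEmpty _
  s_comp := fun x => x.elim
  t_comp := fun x => x.elim
  comp_assoc := fun x => x.elim

/-- all lifting problems from the boundary inclusion to `p` -/
def LiftCells {X Y : Flow} (n : ℕ) (p : FlowHom Y X) : Type :=
  {ab : FlowHom (Glob (diskBoundary n)) Y × FlowHom (Glob (closedDisk n)) X //
    ab.2.comp (globBoundaryInclusion n) = p.comp ab.1}

/-- a flow over `X` -/
structure Stage (X : Flow) : Type 1 where
  Y : Flow
  p : FlowHom Y X

variable (X : Flow)

/-- the attaching maps of the next step -/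
def nextAtt {X Y : Flow} (n : ℕ) (p : FlowHom Y X) (c : LiftCells n p) :
    FlowHom (Glob (diskBoundary n)) Y := c.1.1

/-- the projection of the first stage -/
def discHom : FlowHom (discFlow X.State) X where
  toFun0 := fun x => x
  toFunP := fun e => e.elim
  continuous_toFunP := continuous_of_isEmpty (α := Empty) _
  s_map := fun e => e.elim
  t_map := fun e => e.elim
  comp_map := fun e => e.elim

/-- the skeleta -/
noncomputable def stage : ℕ → Stage X
  | 0 => ⟨discFlow X.State, discHom X⟩
  | n + 1 => ⟨Attach (nextAtt n (stage n).p), attDesc (stage n).p (fun c => c.1.2) (fun c => c.2)⟩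

/-- skeleta -/
noncomputable def sk (n : ℕ) : Flow := (stage X n).Y
/-- projection of the skeleta -/
noncomputable def skp (n : ℕ) : FlowHom (sk X n) X := (stage X n).p
/-- cells -/
def skCells (n : ℕ) : Type := LiftCells n (skp X n)
/-- attaching maps -/
noncomputable def skAtt (n : ℕ) (c : skCells X n) : FlowHom (Glob (diskBoundary n)) (sk X n) :=
  c.1.1

theorem sk_succ (n : ℕ) : sk X (n + 1) = Attach (skAtt X n) := rfl

/-- inclusions -/
noncomputable def skι (n : ℕ) : FlowHom (sk X n) (sk X (n + 1)) := attι (skAtt X n)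
/-- characteristic maps -/
noncomputable def skCell (n : ℕ) (c : skCells X n) :
    FlowHom (Glob (closedDisk n)) (sk X (n + 1)) := attCell (skAtt X n) c

theorem skp_ι (n : ℕ) : (skp X (n + 1)).comp (skι X n) = skp X n :=
  attDesc_ι (a := skAtt X n) _ _ _

theorem skp_cell (n : ℕ) (c : skCells X n) : (skp X (n + 1)).comp (skCell X n c) = c.1.2 :=
  attDesc_cell (a := skAtt X n) _ _ _ c

theorem skp_bij (n : ℕ) : Function.Bijective (skp X n).toFun0 := by
  induction n with
  | zero => exact Function.bijective_id
  | succ n ih => exact ih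

theorem isEmpty_sk_zero : IsEmpty (sk X 0).Path := inferInstanceAs (IsEmpty Empty)

/-- presentation of the colimit -/
noncomputable def colPres : Pres where
  S := X.State
  G := Σ n, (sk X n).Path
  src g := (skp X g.1).toFun0 ((sk X g.1).s g.2)
  tgt g := (skp X g.1).toFun0 ((sk X g.1).t g.2)
  adm Z z0 zP := ∃ d : ∀ n, FlowHom (sk X n) Z, (∀ n, (d (n + 1)).comp (skι X n) = d n) ∧
    (∀ n, (d n).toFun0 = z0 ∘ (skp X n).toFun0) ∧ ∀ n x, (d n).toFunP x = zP ⟨n, x⟩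
  adm_s := by
    rintro Z z0 zP ⟨d, h1, h2, h3⟩ ⟨n, x⟩
    rw [← h3, (d n).s_map, h2]; rfl
  adm_t := by
    rintro Z z0 zP ⟨d, h1, h2, h3⟩ ⟨n, x⟩
    rw [← h3, (d n).t_map, h2]; rfl

/-- the cellular resolution -/
noncomputable def Res : Flow := (colPres X).U

theorem isOpen_s_of {A : Flow} (f : A.State → X.State) (b : X.State) :
    IsOpen {x : A.Path | f (A.s x) = b} := by
  have : {x : A.Path | f (A.s x) = b} = ⋃ c : {c // f c = b}, A.s ⁻¹' {c.1} := by
    ext x; simp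
  rw [this]; exact isOpen_iUnion fun c => A.isOpen_preimage_s _

theorem isOpen_t_of {A : Flow} (f : A.State → X.State) (b : X.State) :
    IsOpen {x : A.Path | f (A.t x) = b} := by
  have : {x : A.Path | f (A.t x) = b} = ⋃ c : {c // f c = b}, A.t ⁻¹' {c.1} := by
    ext x; simp
  rw [this]; exact isOpen_iUnion fun c => A.isOpen_preimage_t _

/-- inclusions of the skeleta -/
noncomputable def resIncl (n : ℕ) : FlowHom (sk X n) (Res X) where
  toFun0 := (skp X n).toFun0
  toFunP x := (colPres X).gen ⟨n, x⟩
  continuous_toFunP := by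
    refine Pres.continuous_to_U _ ?_ ?_
    · intro p q
      exact (isOpen_s_of X (A := sk X n) (skp X n).toFun0 p).inter
        (isOpen_t_of X (A := sk X n) (skp X n).toFun0 q)
    · rintro Z ⟨z0, zP, hc⟩
      obtain ⟨d, h1, h2, h3⟩ := id hc
      exact (d n).continuous_toFunP.congr (h3 n)
  s_map y := rfl
  t_map y := rfl
  comp_map x y h h' := by
    refine Pres.U_ext ?_ ?_ ?_
    · exact (congrArg (skp X n).toFun0 ((sk X n).s_comp x y h)).trans
        ((colPres X).U.s_comp _ _ h').symm
    · exact (congrArg (skp X n).toFun0 ((sk X n).t_comp x y h)).trans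
        ((colPres X).U.t_comp _ _ h').symm
    · rintro Z ⟨z0, zP, hc⟩
      obtain ⟨d, h1, h2, h3⟩ := id hc
      refine Eq.trans ?_ (FlowHom.comp_map _ _ _ h' (FlowHom.ht _ h')).symm
      refine (h3 _ _).symm.trans (((d n).comp_map x y h ((d n).ht h)).trans ?_)
      exact Z.comp_congr (h3 n x) (h3 n y) _ _

theorem resIncl_ι (n : ℕ) : (resIncl X (n + 1)).comp (skι X n) = resIncl X n := by
  refine FlowHom.ext rfl (funext fun x => ?_)
  refine Pres.U_ext ?_ ?_ ?_
  · rfl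
  · rfl
  · rintro Z ⟨z0, zP, hc⟩
    obtain ⟨d, h1, h2, h3⟩ := id hc
    exact (h3 _ _).symm.trans ((FlowHom.congrP (h1 n) x).trans (h3 _ _))

theorem res_isColimit (Z : Flow) (d : ∀ n, FlowHom (sk X n) Z)
    (hd : ∀ n, (d (n + 1)).comp (skι X n) = d n) :
    ∃! h : FlowHom (Res X) Z, ∀ n, h.comp (resIncl X n) = d n := by
  have h0 : ∀ n, (d n).toFun0 = (d 0).toFun0 ∘ (skp X n).toFun0 := by
    intro n
    induction n with
    | zero => rfl
    | succ n ih =>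
      have : (d (n + 1)).toFun0 = (d n).toFun0 := congrArg FlowHom.toFun0 (hd n)
      exact this.trans ih
  let c : (colPres X).Coc Z := ⟨(d 0).toFun0, fun g => (d g.1).toFunP g.2, d, hd, h0,
    fun _ _ => rfl⟩
  refine ⟨c.lift, fun n => FlowHom.ext (h0 n).symm rfl, fun f hf => ?_⟩
  refine Pres.U_hom_ext (funext fun x => FlowHom.congr0 (hf 0) x) ?_
  rintro ⟨n, x⟩
  exact FlowHom.congrP (hf n) x

/-- the projection of the resolution -/
noncomputable def resp : FlowHom (Res X) X :=
  Pres.Coc.lift (P := colPres X) ⟨fun x => x, fun g => (skp X g.1).toFunP g.2, skp X, skp_ι X,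
    fun _ => rfl, fun _ _ => rfl⟩

theorem resp_incl (n : ℕ) : (resp X).comp (resIncl X n) = skp X n := FlowHom.ext rfl rfl

theorem resp_bij : Function.Bijective (resp X).toFun0 := Function.bijective_id

theorem res_sCofibrant : SCofibrant (Res X) :=
  ⟨{  sk := sk X
      isEmpty_path_sk_zero := isEmpty_sk_zero X
      ι := skι X
      cells := skCells X
      attachMap := skAtt X
      cellMap := skCell X
      attach_comm := fun n i => att_comm (skAtt X n) i
      attach_isPushout := fun n Z g k h => att_isPushout (skAtt X n) Z g k h
      incl := resIncl X
      incl_comm := resIncl_ι X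
      isColimit := res_isColimit X }⟩

/-- transition maps -/
noncomputable def skle {n m : ℕ} (h : n ≤ m) : FlowHom (sk X n) (sk X m) :=
  (Functor.ofSequence (C := Flow) (X := sk X) (skι X)).map (homOfLE h)

theorem skle_refl (n : ℕ) : skle X (le_refl n) = FlowHom.id _ :=
  (Functor.ofSequence (C := Flow) (X := sk X) (skι X)).map_id n

theorem skle_trans {n m k : ℕ} (h : n ≤ m) (h' : m ≤ k) :
    skle X (h.trans h') = (skle X h').comp (skle X h) :=
  (Functor.ofSequence (C := Flow) (X := sk X) (skι X)).map_comp (homOfLE h) (homOfLE h')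

theorem skle_succ (n : ℕ) (h : n ≤ n + 1) : skle X h = skι X n :=
  Functor.ofSequence_map_homOfLE_succ (C := Flow) (X := sk X) (skι X) n

theorem comp_id {A B : Flow} (f : FlowHom A B) : f.comp (FlowHom.id A) = f := FlowHom.ext rfl rfl

theorem skle_of {Z : Flow} (d : ∀ n, FlowHom (sk X n) Z)
    (hd : ∀ n, (d (n + 1)).comp (skι X n) = d n) {n m : ℕ} (h : n ≤ m) :
    (d m).comp (skle X h) = d n := by
  induction m, h using Nat.le_induction with
  | base => rw [skle_refl]; rfl
  | succ m h ih =>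
    rw [skle_trans X h (Nat.le_succ m), ← FlowHom.comp_assoc, skle_succ, hd, ih]

theorem range_incl_mono {n m : ℕ} (h : n ≤ m) :
    Set.range (resIncl X n).toFunP ⊆ Set.range (resIncl X m).toFunP := by
  rintro _ ⟨x, rfl⟩
  exact ⟨(skle X h).toFunP x, FlowHom.congrP (skle_of X _ (resIncl_ι X) h) x⟩

theorem res_exists (x : (Res X).Path) : ∃ n, x ∈ Set.range (resIncl X n).toFunP := by
  refine Pres.U_ind (P := colPres X)
    (motive := fun x => ∃ n, x ∈ Set.range (resIncl X n).toFunP) ?_ ?_ x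
  · rintro ⟨n, x⟩
    exact ⟨n, x, rfl⟩
  · rintro x y h ⟨n, hn⟩ ⟨m, hm⟩
    obtain ⟨x', rfl⟩ := range_incl_mono X (le_max_left n m) hn
    obtain ⟨y', rfl⟩ := range_incl_mono X (le_max_right n m) hm
    have h' : (sk X _).t x' = (sk X _).s y' := (skp_bij X _).1 h
    exact ⟨max n m, (sk X _).comp x' y' h', (resIncl X _).comp_map x' y' h' h⟩

theorem sk_ind {n : ℕ} {motive : (sk X (n + 1)).Path → Prop}
    (hι : ∀ y, motive ((skι X n).toFunP y))
    (hcell : ∀ j c, motive ((skCell X n j).toFunP c))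
    (hc : ∀ (x y : (sk X (n + 1)).Path) (h : (sk X (n + 1)).t x = (sk X (n + 1)).s y),
      motive x → motive y → motive ((sk X (n + 1)).comp x y h)) (x : (sk X (n + 1)).Path) :
    motive x := att_ind (a := skAtt X n) hι hcell hc x

end

section
theorem norm_bdry {n : ℕ} (c : diskBoundary n) :
    ‖((diskBoundaryInclusion n c : closedDisk n) : EuclideanSpace ℝ (Fin n))‖ = 1 := by
  show ‖(c : EuclideanSpace ℝ (Fin n))‖ = 1
  simp

/-! ### one-state flows -/

/-- the flow with one state and a topological semigroup as path space -/
def oneFlow (M : Type) [TopologicalSpace M] (op : M → M → M)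
    (hop : Continuous fun p : M × M => op p.1 p.2)
    (hassoc : ∀ x y z, op x (op y z) = op (op x y) z) : Flow where
  State := PUnit
  Path := M
  s _ := PUnit.unit
  t _ := PUnit.unit
  isOpen_preimage_s a := isOpen_preimage_const _ a
  isOpen_preimage_t a := isOpen_preimage_const _ a
  comp x y _ := op x y
  continuous_comp := hop.comp continuous_subtype_val
  s_comp _ _ _ := rfl
  t_comp _ _ _ := rfl
  comp_assoc x y z _ _ _ _ := hassoc x y z

/-- a word of letters representing a path of the pushout -/
inductive Rep {Y : Flow} {n : ℕ} {J : Type} (a : J → FlowHom (Glob (diskBoundary n)) Y) :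
    (Attach a).Path → List (closedDisk n) → Prop
  | base (y : Y.Path) : Rep a ((attι a).toFunP y) []
  | cell (j : J) (c : closedDisk n) : Rep a ((attCell a j).toFunP c) [c]
  | comp (x y : (Attach a).Path) (h : (Attach a).t x = (Attach a).s y)
      (l l' : List (closedDisk n)) : Rep a x l → Rep a y l' →
      Rep a ((Attach a).comp x y h) (l ++ l')

section
variable {Y : Flow} {n : ℕ} {J : Type} {a : J → FlowHom (Glob (diskBoundary n)) Y}

theorem exists_rep (x : (Attach a).Path) : ∃ l, Rep a x l := by
  induction x using att_ind with
  | hι y => exact ⟨_, .base y⟩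
  | hcell j c => exact ⟨_, .cell j c⟩
  | hc x y h hx hy =>
    obtain ⟨l, hl⟩ := hx
    obtain ⟨l', hl'⟩ := hy
    exact ⟨_, .comp x y h l l' hl hl'⟩

theorem Rep.mem_range {x : (Attach a).Path} {l : List (closedDisk n)} (h : Rep a x l)
    (hl : ∀ c ∈ l, ‖(c : EuclideanSpace ℝ (Fin n))‖ = 1) : x ∈ Set.range (attι a).toFunP := by
  induction h with
  | base y => exact ⟨y, rfl⟩
  | cell j c =>
    have hc : ‖(c : EuclideanSpace ℝ (Fin n))‖ = 1 := hl c (by simp)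
    have := att_comm_apply a j ⟨c, by simpa using hc⟩
    exact ⟨_, this.symm⟩
  | comp x y h l l' hx hy ihx ihy =>
    obtain ⟨x', rfl⟩ := ihx (fun c hc => hl c (by simp [hc]))
    obtain ⟨y', rfl⟩ := ihy (fun c hc => hl c (by simp [hc]))
    have h' : Y.t x' = Y.s y' := h
    exact ⟨Y.comp x' y' h', (attι a).comp_map x' y' h' h⟩

variable (a)

/-- the morphism to a one-state flow sending the base to the unit -/
noncomputable def letterHom (M : Type) [TopologicalSpace M] (op : M → M → M)
    (hop : Continuous fun p : M × M => op p.1 p.2)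
    (hassoc : ∀ x y z, op x (op y z) = op (op x y) z) (e : M) (he : ∀ x, op e x = x)
    (φ : closedDisk n → M) (hφ : Continuous φ)
    (hb : ∀ c : closedDisk n, ‖(c : EuclideanSpace ℝ (Fin n))‖ = 1 → φ c = e) :
    FlowHom (Attach a) (oneFlow M op hop hassoc) :=
  attDesc (Z := oneFlow M op hop hassoc)
    { toFun0 := fun _ => PUnit.unit
      toFunP := fun _ => e
      continuous_toFunP := continuous_const
      s_map := fun _ => rfl
      t_map := fun _ => rfl
      comp_map := fun _ _ _ _ => (he e).symm }
    (fun _ => globHom (Z := oneFlow M op hop hassoc) PUnit.unit PUnit.unit ⟨φ, hφ⟩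
      (fun _ => rfl) (fun _ => rfl))
    (fun _ => FlowHom.ext (funext fun _ => rfl) (funext fun c => hb _ (norm_bdry c)))

theorem letterHom_rep (M : Type) [TopologicalSpace M] (op : M → M → M)
    (hop : Continuous fun p : M × M => op p.1 p.2)
    (hassoc : ∀ x y z, op x (op y z) = op (op x y) z) (e : M) (he : ∀ x, op e x = x)
    (he' : ∀ x, op x e = x)
    (φ : closedDisk n → M) (hφ : Continuous φ)
    (hb : ∀ c : closedDisk n, ‖(c : EuclideanSpace ℝ (Fin n))‖ = 1 → φ c = e)
    {x : (Attach a).Path} {l : List (closedDisk n)} (h : Rep a x l) :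
    (letterHom a M op hop hassoc e he φ hφ hb).toFunP x = l.foldr (fun c m => op (φ c) m) e := by
  have key : ∀ l l' : List (closedDisk n), (l ++ l').foldr (fun c m => op (φ c) m) e =
      op (l.foldr (fun c m => op (φ c) m) e) (l'.foldr (fun c m => op (φ c) m) e) := by
    intro l l'
    induction l with
    | nil => simp [he]
    | cons c l ih =>
      rw [List.cons_append, List.foldr_cons, ih, List.foldr_cons, hassoc]
  induction h with
  | base y => rfl
  | cell j c => exact (he' _).symm
  | comp x y h l l' hx hy ihx ihy =>
    rw [key, ← ihx, ← ihy]
    exact FlowHom.comp_map _ _ _ h rfl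

end

/-! ### naturals with Alexandrov topologies -/

/-- naturals, opens are lower sets -/
structure NLow : Type where
  val : ℕ
/-- naturals, opens are upper sets -/
structure NUp : Type where
  val : ℕ

instance : TopologicalSpace NLow where
  IsOpen s := ∀ p q : NLow, q.val ≤ p.val → p ∈ s → q ∈ s
  isOpen_univ _ _ _ _ := trivial
  isOpen_inter s t hs ht p q h hp := ⟨hs p q h hp.1, ht p q h hp.2⟩
  isOpen_sUnion S hS p q h := by
    rintro ⟨t, ht, hp⟩
    exact ⟨t, ht, hS t ht p q h hp⟩

instance : TopologicalSpace NUp where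
  IsOpen s := ∀ p q : NUp, p.val ≤ q.val → p ∈ s → q ∈ s
  isOpen_univ _ _ _ _ := trivial
  isOpen_inter s t hs ht p q h hp := ⟨hs p q h hp.1, ht p q h hp.2⟩
  isOpen_sUnion S hS p q h := by
    rintro ⟨t, ht, hp⟩
    exact ⟨t, ht, hS t ht p q h hp⟩

theorem isOpen_NLow_iff (s : Set NLow) :
    IsOpen s ↔ ∀ p q : NLow, q.val ≤ p.val → p ∈ s → q ∈ s := Iff.rfl

theorem isOpen_NUp_iff (s : Set NUp) :
    IsOpen s ↔ ∀ p q : NUp, p.val ≤ q.val → p ∈ s → q ∈ s := Iff.rfl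

theorem isOpen_NLow (r : ℕ) : IsOpen {m : NLow | m.val ≤ r} :=
  (isOpen_NLow_iff _).2 fun _ _ h hp => le_trans h hp

theorem isOpen_NUp (r : ℕ) : IsOpen {m : NUp | r ≤ m.val} :=
  (isOpen_NUp_iff _).2 fun _ _ h hp => le_trans hp h

theorem continuous_NLow {A : Type*} [TopologicalSpace A] (f : A → ℕ)
    (h : ∀ r, IsOpen {x | f x ≤ r}) : Continuous (fun x => NLow.mk (f x)) := by
  refine continuous_def.2 fun s hs => isOpen_iff_forall_mem_open.2 fun x hx => ?_
  exact ⟨_, fun y hy => (isOpen_NLow_iff s).1 hs _ _ hy hx, h (f x), le_refl (f x)⟩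

theorem continuous_NUp {A : Type*} [TopologicalSpace A] (f : A → ℕ)
    (h : ∀ r, IsOpen {x | r ≤ f x}) : Continuous (fun x => NUp.mk (f x)) := by
  refine continuous_def.2 fun s hs => isOpen_iff_forall_mem_open.2 fun x hx => ?_
  exact ⟨_, fun y hy => (isOpen_NUp_iff s).1 hs _ _ hy hx, h (f x), le_refl (f x)⟩

theorem continuous_op_NLow (op : ℕ → ℕ → ℕ) (h : ∀ a b c d, a ≤ c → b ≤ d → op a b ≤ op c d) :
    Continuous (fun p : NLow × NLow => NLow.mk (op p.1.val p.2.val)) := by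
  refine continuous_NLow _ fun r => isOpen_iff_forall_mem_open.2 fun x hx => ?_
  refine ⟨{m : NLow | m.val ≤ x.1.val} ×ˢ {m : NLow | m.val ≤ x.2.val}, fun y hy => ?_,
    (isOpen_NLow x.1.val).prod (isOpen_NLow x.2.val), le_refl x.1.val, le_refl x.2.val⟩
  exact le_trans (h _ _ _ _ hy.1 hy.2) hx

theorem continuous_op_NUp (op : ℕ → ℕ → ℕ) (h : ∀ a b c d, a ≤ c → b ≤ d → op a b ≤ op c d) :
    Continuous (fun p : NUp × NUp => NUp.mk (op p.1.val p.2.val)) := by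
  refine continuous_NUp _ fun r => isOpen_iff_forall_mem_open.2 fun x hx => ?_
  refine ⟨{m : NUp | x.1.val ≤ m.val} ×ˢ {m : NUp | x.2.val ≤ m.val}, fun y hy => ?_,
    (isOpen_NUp x.1.val).prod (isOpen_NUp x.2.val), le_refl x.1.val, le_refl x.2.val⟩
  exact le_trans hx (h _ _ _ _ hy.1 hy.2)

/-! ### path powers -/

/-- the flow of families of paths indexed by `B` -/
noncomputable def powFlow (B : Type) [TopologicalSpace B] [LocallyCompactSpace B] [Nonempty B]
    (Z : Flow) : Flow where
  State := Z.State
  Path := {σ : C(B, Z.Path) // (∀ b b', Z.s (σ b) = Z.s (σ b')) ∧ ∀ b b', Z.t (σ b) = Z.t (σ b')}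
  s σ := Z.s (σ.1 (Classical.arbitrary B))
  t σ := Z.t (σ.1 (Classical.arbitrary B))
  isOpen_preimage_s p := (Z.isOpen_preimage_s p).preimage
    ((continuous_eval_const _).comp continuous_subtype_val)
  isOpen_preimage_t p := (Z.isOpen_preimage_t p).preimage
    ((continuous_eval_const _).comp continuous_subtype_val)
  comp σ τ h := ⟨⟨fun b => Z.comp (σ.1 b) (τ.1 b)
      ((σ.2.2 _ _).trans (h.trans (τ.2.1 _ _))), by
        have := Z.continuous_comp.comp (Continuous.subtype_mk (p := fun p : Z.Path × Z.Path => Z.t p.1 = Z.s p.2)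
          (f := fun b : B => ((σ.1 b, τ.1 b) : Z.Path × Z.Path))
          (σ.1.continuous.prodMk τ.1.continuous)
          (fun b => ((σ.2.2 _ _).trans (h.trans (τ.2.1 _ _)))))
        exact this⟩, by
        constructor
        · intro b b'
          exact (Z.s_comp _ _ _).trans ((σ.2.1 b b').trans (Z.s_comp _ _ _).symm)
        · intro b b'
          exact (Z.t_comp _ _ _).trans ((τ.2.2 b b').trans (Z.t_comp _ _ _).symm)⟩
  continuous_comp := by
    refine Continuous.subtype_mk ?_ _
    refine ContinuousMap.continuous_of_continuous_uncurry _ ?_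
    have key : ∀ {W : Type} [TopologicalSpace W] (f g : W → Z.Path) (hf : Continuous f)
        (hg : Continuous g) (h : ∀ w, Z.t (f w) = Z.s (g w)),
        Continuous fun w => Z.comp (f w) (g w) (h w) := fun f g hf hg h =>
      Z.continuous_comp.comp (Continuous.subtype_mk
      (p := fun p : Z.Path × Z.Path => Z.t p.1 = Z.s p.2) (hf.prodMk hg) h)
    refine key _ _ ?_ ?_ _
    · refine Continuous.eval ?_ continuous_snd
      exact continuous_subtype_val.comp (continuous_fst.comp
          (continuous_subtype_val.comp continuous_fst))
    · refine Continuous.eval ?_ continuous_snd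
      exact continuous_subtype_val.comp (continuous_snd.comp
          (continuous_subtype_val.comp continuous_fst))
  s_comp _ _ _ := Z.s_comp _ _ _
  t_comp _ _ _ := Z.t_comp _ _ _
  comp_assoc σ τ υ h h' h1 h2 := by
    refine Subtype.ext (ContinuousMap.ext fun b => ?_)
    exact Z.comp_assoc _ _ _ _ _ _ _

section
variable {Y : Flow} {n : ℕ} {J : Type} (a : J → FlowHom (Glob (diskBoundary n)) Y)
variable {B : Type} [TopologicalSpace B] [LocallyCompactSpace B] [Nonempty B]

theorem def_exists (G : B × closedDisk n → closedDisk n) (hG : Continuous G)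
    (hb : ∀ b (c : closedDisk n), ‖(c : EuclideanSpace ℝ (Fin n))‖ = 1 → G (b, c) = c) :
    ∃ Φ : B × (Attach a).Path → (Attach a).Path, Continuous Φ ∧
      (∀ b x l, Rep a x l → Rep a (Φ (b, x)) (l.map fun c => G (b, c))) ∧
      ∀ b, (∀ c, G (b, c) = c) → ∀ x, Φ (b, x) = x := by
  let g : FlowHom Y (powFlow B (Attach a)) :=
    { toFun0 := (attι a).toFun0
      toFunP := fun y => ⟨ContinuousMap.const B ((attι a).toFunP y),
        fun _ _ => rfl, fun _ _ => rfl⟩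
      continuous_toFunP := by
        refine Continuous.subtype_mk ?_ _
        exact ContinuousMap.continuous_const'.comp (attι a).continuous_toFunP
      s_map := fun y => (attι a).s_map y
      t_map := fun y => (attι a).t_map y
      comp_map := fun x y h h' => by
        refine Subtype.ext (ContinuousMap.ext fun b => ?_)
        exact (attι a).comp_map x y h h' }
  let k : J → FlowHom (Glob (closedDisk n)) (powFlow B (Attach a)) := fun j =>
    { toFun0 := (a j).toFun0
      toFunP := fun c => ⟨⟨fun b => (attCell a j).toFunP (G (b, c)),
        (attCell a j).continuous_toFunP.comp (hG.comp (Continuous.prodMk_left c))⟩,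
        fun _ _ => rfl, fun _ _ => rfl⟩
      continuous_toFunP := by
        refine Continuous.subtype_mk ?_ _
        refine ContinuousMap.continuous_of_continuous_uncurry _ ?_
        exact (attCell a j).continuous_toFunP.comp (hG.comp continuous_swap)
      s_map := fun y => rfl
      t_map := fun y => rfl
      comp_map := fun x y h => absurd (show (1 : Fin 2) = 0 from h) (by decide) }
  have hk : ∀ j, (k j).comp (globBoundaryInclusion n) = g.comp (a j) := by
    intro j
    refine FlowHom.ext rfl (funext fun c => Subtype.ext (ContinuousMap.ext fun b => ?_))
    have hc : ‖((diskBoundaryInclusion n c : closedDisk n) : EuclideanSpace ℝ (Fin n))‖ = 1 :=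
      norm_bdry c
    exact (congrArg (attCell a j).toFunP (hb b _ hc)).trans (att_comm_apply a j c)
  let F := attDesc (a := a) g k hk
  refine ⟨fun p => (F.toFunP p.2).1 p.1, ?_, ?_, ?_⟩
  · exact (continuous_eval (F := C(B, (Attach a).Path))).comp
      ((continuous_subtype_val.comp (F.continuous_toFunP.comp continuous_snd)).prodMk
        continuous_fst)
  · intro b x l h
    induction h with
    | base y => exact Rep.base y
    | cell j c => exact Rep.cell j _
    | comp x y h l l' hx hy ihx ihy =>
      rw [List.map_append]
      have h1 := F.ht h
      have h2 := F.comp_map x y h h1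
      dsimp only at ihx ihy ⊢
      rw [h2]
      exact Rep.comp _ _ (((F.toFunP x).2.2 _ _).trans (h1.trans ((F.toFunP y).2.1 _ _))) _ _ ihx ihy
  · intro b hG0 x
    induction x using att_ind with
    | hι y => rfl
    | hcell j c => exact congrArg (attCell a j).toFunP (hG0 c)
    | hc x y h hx hy =>
      have h1 := F.ht h
      have h2 := F.comp_map x y h h1
      dsimp only at hx hy ⊢
      rw [h2]
      exact (Attach a).comp_congr hx hy (((F.toFunP x).2.2 _ _).trans (h1.trans ((F.toFunP y).2.1 _ _))) _

end

end

section
/-! ### radial directions -/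

/-- direction of a nonzero vector of the disk -/
noncomputable def dir {n : ℕ} (y : EuclideanSpace ℝ (Fin n)) (h : y ≠ 0) : diskBoundary n :=
  ⟨‖y‖⁻¹ • y, by simp [norm_smul, h]⟩

theorem dir_of_norm {n : ℕ} (y : EuclideanSpace ℝ (Fin n)) (h : y ≠ 0) (hy : ‖y‖ = 1) :
    (dir y h : EuclideanSpace ℝ (Fin n)) = y := by
  simp [dir, hy]

theorem dir_bdry {n : ℕ} (y : diskBoundary n) (h : (y : EuclideanSpace ℝ (Fin n)) ≠ 0) :
    dir (y : EuclideanSpace ℝ (Fin n)) h = y :=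
  Subtype.ext (dir_of_norm _ _ (by simp))

theorem bdry_ne_zero {n : ℕ} (y : diskBoundary n) : (y : EuclideanSpace ℝ (Fin n)) ≠ 0 := by
  intro h
  have : ‖(y : EuclideanSpace ℝ (Fin n))‖ = 1 := by simp
  rw [h] at this
  simp at this

theorem isOpen_dir {n : ℕ} {W : Set (diskBoundary n)} (hW : IsOpen W) :
    IsOpen {y : closedDisk n | ∃ h : (y : EuclideanSpace ℝ (Fin n)) ≠ 0, dir _ h ∈ W} := by
  have h1 : IsOpen {y : closedDisk n | (y : EuclideanSpace ℝ (Fin n)) ≠ 0} :=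
    isOpen_ne_fun continuous_subtype_val continuous_const
  have h2 : Continuous (fun y : {y : closedDisk n // (y : EuclideanSpace ℝ (Fin n)) ≠ 0} =>
      dir (y.1 : EuclideanSpace ℝ (Fin n)) y.2) := by
    refine Continuous.subtype_mk ?_ _
    have h4 : Continuous (fun y : {y : closedDisk n // (y : EuclideanSpace ℝ (Fin n)) ≠ 0} =>
      (y.1 : EuclideanSpace ℝ (Fin n))) := continuous_subtype_val.comp continuous_subtype_val
    exact Continuous.smul (Continuous.inv₀ h4.norm (fun y => norm_ne_zero_iff.2 y.2)) h4
  have h3 := h1.isOpenMap_subtype_val _ (hW.preimage h2)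
  convert h3 using 1
  ext y
  constructor
  · rintro ⟨h, hy⟩
    exact ⟨⟨y, h⟩, hy, rfl⟩
  · rintro ⟨⟨y, h⟩, hy, rfl⟩
    exact ⟨h, hy⟩

/-! ### the cone on a flow -/

section cone
variable (Z : Flow)

/-- paths of the cone -/
inductive ConePath : Type
  | pt (x : Z.Path) : ConePath
  | inf (α β : Z.State) : ConePath

namespace ConePath
variable {Z}

/-- source -/
def s : ConePath Z → Z.State
  | pt x => Z.s x
  | inf α _ => α
/-- target -/
def t : ConePath Z → Z.State
  | pt x => Z.t x
  | inf _ β => β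
/-- composition -/
def comp : ∀ x y : ConePath Z, x.t = y.s → ConePath Z
  | pt x, pt y, h => pt (Z.comp x y h)
  | inf α _, y, _ => inf α y.t
  | pt x, inf _ β, _ => inf (Z.s x) β

instance : TopologicalSpace (ConePath Z) where
  IsOpen V := IsOpen (pt ⁻¹' V) ∧ ∀ α β, inf α β ∈ V → ∀ x : ConePath Z, x.s = α → x.t = β → x ∈ V
  isOpen_univ := ⟨isOpen_univ, fun _ _ _ _ _ _ => trivial⟩
  isOpen_inter V W hV hW := ⟨hV.1.inter hW.1, fun α β h x hs ht =>
    ⟨hV.2 α β h.1 x hs ht, hW.2 α β h.2 x hs ht⟩⟩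
  isOpen_sUnion S hS := ⟨by
    rw [Set.preimage_sUnion]
    exact isOpen_biUnion fun t ht => (hS t ht).1, by
    rintro α β ⟨t, ht, h⟩ x hs ht'
    exact ⟨t, ht, (hS t ht).2 α β h x hs ht'⟩⟩

theorem isOpen_iff (V : Set (ConePath Z)) : IsOpen V ↔ IsOpen (pt ⁻¹' V) ∧
    ∀ α β, inf α β ∈ V → ∀ x : ConePath Z, x.s = α → x.t = β → x ∈ V := Iff.rfl

theorem isOpen_s (α : Z.State) : IsOpen {x : ConePath Z | x.s = α} := by
  rw [isOpen_iff]
  refine ⟨Z.isOpen_preimage_s α, ?_⟩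
  rintro α' β h x hs ht
  exact hs.trans h

theorem isOpen_t (α : Z.State) : IsOpen {x : ConePath Z | x.t = α} := by
  rw [isOpen_iff]
  refine ⟨Z.isOpen_preimage_t α, ?_⟩
  rintro α' β h x hs ht
  exact ht.trans h

theorem isOpenEmbedding_pt : Topology.IsOpenEmbedding (pt : Z.Path → ConePath Z) := by
  refine Topology.IsOpenEmbedding.of_continuous_injective_isOpenMap ?_ ?_ ?_
  · exact continuous_def.2 fun V hV => ((isOpen_iff V).1 hV).1
  · intro x y h; injection h
  · intro U hU
    rw [isOpen_iff]
    refine ⟨?_, ?_⟩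
    · rw [Set.preimage_image_eq]
      · exact hU
      · intro x y h; injection h
    · rintro α β ⟨x, hx, h⟩
      cases h

theorem s_comp (x y : ConePath Z) (h : x.t = y.s) : (comp x y h).s = x.s := by
  cases x <;> cases y
  · exact Z.s_comp _ _ _
  all_goals rfl

theorem t_comp (x y : ConePath Z) (h : x.t = y.s) : (comp x y h).t = y.t := by
  cases x <;> cases y
  · exact Z.t_comp _ _ _
  all_goals rfl

theorem comp_cases (x y : ConePath Z) (h : x.t = y.s) :
    (∃ (x' y' : Z.Path) (h' : Z.t x' = Z.s y'), x = pt x' ∧ y = pt y' ∧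
      comp x y h = pt (Z.comp x' y' h')) ∨ comp x y h = inf x.s y.t := by
  cases x <;> cases y
  · exact Or.inl ⟨_, _, h, rfl, rfl, rfl⟩
  all_goals exact Or.inr rfl

end ConePath

/-- the cone flow -/
def coneFlow : Flow where
  State := Z.State
  Path := ConePath Z
  s := ConePath.s
  t := ConePath.t
  isOpen_preimage_s := ConePath.isOpen_s
  isOpen_preimage_t := ConePath.isOpen_t
  comp := ConePath.comp
  s_comp := ConePath.s_comp
  t_comp := ConePath.t_comp
  comp_assoc x y z hxy hyz h1 h2 := by
    cases x <;> cases y <;> cases z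
    · exact congrArg ConePath.pt (Z.comp_assoc _ _ _ _ _ _ _)
    all_goals first
      | rfl
      | exact congrArg (fun q => ConePath.inf q _) (Z.s_comp _ _ _).symm
      | exact congrArg (fun q => ConePath.inf _ q) (Z.t_comp _ _ _)
  continuous_comp := by
    refine continuous_def.2 fun V hV => isOpen_iff_forall_mem_open.2 ?_
    rintro ⟨⟨x, y⟩, h⟩ hx
    change ConePath.comp x y h ∈ V at hx
    rcases ConePath.comp_cases x y h with ⟨x', y', h', rfl, rfl, e⟩ | e
    · rw [e] at hx
      have hV' := Z.continuous_comp.isOpen_preimage _ ((ConePath.isOpen_iff V).1 hV).1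
      obtain ⟨U, hU, hUV⟩ := isOpen_induced_iff.1 hV'
      have hxU : (x', y') ∈ U := by
        have : (⟨(x', y'), h'⟩ : {p : Z.Path × Z.Path // Z.t p.1 = Z.s p.2}) ∈
          Subtype.val ⁻¹' U := by rw [hUV]; exact hx
        exact this
      obtain ⟨A, B, hA, hB, hxA, hyB, hAB⟩ := isOpen_prod_iff.1 hU x' y' hxU
      refine ⟨Subtype.val ⁻¹' ((ConePath.pt '' A) ×ˢ (ConePath.pt '' B)), ?_,
        (((ConePath.isOpenEmbedding_pt.isOpenMap _ hA).prod
          (ConePath.isOpenEmbedding_pt.isOpenMap _ hB))).preimage continuous_subtype_val,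
        ⟨x', hxA, rfl⟩, ⟨y', hyB, rfl⟩⟩
      rintro ⟨⟨_, _⟩, hh⟩ ⟨⟨x1, hx1, rfl⟩, ⟨y1, hy1, rfl⟩⟩
      have : (⟨(x1, y1), hh⟩ : {p : Z.Path × Z.Path // Z.t p.1 = Z.s p.2}) ∈
          Subtype.val ⁻¹' U := hAB ⟨hx1, hy1⟩
      rw [hUV] at this
      exact this
    · rw [e] at hx
      refine ⟨Subtype.val ⁻¹' ({x1 | ConePath.s x1 = x.s} ×ˢ {y1 | ConePath.t y1 = y.t}), ?_,
        ((ConePath.isOpen_s _).prod (ConePath.isOpen_t _)).preimage continuous_subtype_val,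
        rfl, rfl⟩
      rintro ⟨⟨x1, y1⟩, hh⟩ ⟨h1, h2⟩
      refine ((ConePath.isOpen_iff V).1 hV).2 _ _ hx _ ?_ ?_
      · exact (ConePath.s_comp _ _ _).trans h1
      · exact (ConePath.t_comp _ _ _).trans h2

/-- inclusion in the cone -/
def coneIn : FlowHom Z (coneFlow Z) where
  toFun0 x := x
  toFunP := ConePath.pt
  continuous_toFunP := ConePath.isOpenEmbedding_pt.continuous
  s_map _ := rfl
  t_map _ := rfl
  comp_map _ _ _ _ := rfl

variable {Z}

open Classical in
/-- extension over the disk -/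
noncomputable def coneFun {n : ℕ} (f : diskBoundary n → ConePath Z) (α β : Z.State)
    (y : closedDisk n) : ConePath Z :=
  if h : (y : EuclideanSpace ℝ (Fin n)) ≠ 0 then f (dir _ h) else ConePath.inf α β

theorem coneFun_s {n : ℕ} (f : diskBoundary n → ConePath Z) (α β : Z.State)
    (hf : ∀ y, (f y).s = α) (y : closedDisk n) : (coneFun f α β y).s = α := by
  unfold coneFun
  split_ifs
  · exact hf _
  · rfl

theorem coneFun_t {n : ℕ} (f : diskBoundary n → ConePath Z) (α β : Z.State)
    (hf : ∀ y, (f y).t = β) (y : closedDisk n) : (coneFun f α β y).t = β := by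
  unfold coneFun
  split_ifs
  · exact hf _
  · rfl

theorem continuous_coneFun {n : ℕ} (f : diskBoundary n → ConePath Z) (α β : Z.State)
    (hc : Continuous f) (hs : ∀ y, (f y).s = α) (ht : ∀ y, (f y).t = β) :
    Continuous (coneFun f α β) := by
  refine continuous_def.2 fun V hV => ?_
  by_cases hi : ConePath.inf α β ∈ V
  · convert isOpen_univ
    refine Set.eq_univ_of_forall fun y => ?_
    exact ((ConePath.isOpen_iff V).1 hV).2 _ _ hi _ (coneFun_s f α β hs y) (coneFun_t f α β ht y)
  · have := isOpen_dir (hV.preimage hc)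
    convert this using 1
    ext y
    rw [Set.mem_preimage]
    unfold coneFun
    by_cases h : (y : EuclideanSpace ℝ (Fin n)) ≠ 0
    · rw [dif_pos h]
      exact ⟨fun hh => ⟨h, hh⟩, fun ⟨_, hh⟩ => hh⟩
    · rw [dif_neg h]
      exact ⟨fun hh => absurd hh hi, fun ⟨habs, _⟩ => absurd habs h⟩

/-- extension over the disk -/
noncomputable def coneExt {n : ℕ} (f : FlowHom (Glob (diskBoundary n)) (coneFlow Z)) :
    FlowHom (Glob (closedDisk n)) (coneFlow Z) where
  toFun0 := f.toFun0
  toFunP := coneFun f.toFunP (f.toFun0 (gs _)) (f.toFun0 (gt _))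
  continuous_toFunP := continuous_coneFun _ _ _ f.continuous_toFunP f.s_map f.t_map
  s_map y := coneFun_s f.toFunP (f.toFun0 (gs _)) (f.toFun0 (gt _)) f.s_map y
  t_map y := coneFun_t f.toFunP (f.toFun0 (gs _)) (f.toFun0 (gt _)) f.t_map y
  comp_map x y h := absurd (show (1 : Fin 2) = 0 from h) (by decide)

theorem coneExt_bdry {n : ℕ} (f : FlowHom (Glob (diskBoundary n)) (coneFlow Z)) :
    (coneExt f).comp (globBoundaryInclusion n) = f := by
  refine FlowHom.ext rfl (funext fun (y : diskBoundary n) => ?_)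
  refine (dif_pos (bdry_ne_zero y)).trans ?_
  exact congrArg f.toFunP (dir_bdry y _)

end cone

/-- extension of a morphism to a cone over a pushout -/
noncomputable def coneAtt {Y Z : Flow} {n : ℕ} {J : Type}
    (a : J → FlowHom (Glob (diskBoundary n)) Y) (g : FlowHom Y (coneFlow Z)) :
    FlowHom (Attach a) (coneFlow Z) :=
  attDesc g (fun j => coneExt (g.comp (a j))) (fun _ => coneExt_bdry _)

theorem coneAtt_ι {Y Z : Flow} {n : ℕ} {J : Type}
    (a : J → FlowHom (Glob (diskBoundary n)) Y) (g : FlowHom Y (coneFlow Z)) :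
    (coneAtt a g).comp (attι a) = g := attDesc_ι _ _ _

theorem isEmbedding_of_cone {Y Z : Flow} (i : FlowHom Y Z) (r : FlowHom Z (coneFlow Y))
    (h : r.comp i = coneIn Y) : Topology.IsEmbedding i.toFunP := by
  refine Topology.IsEmbedding.of_comp i.continuous_toFunP r.continuous_toFunP ?_
  have : r.toFunP ∘ i.toFunP = ConePath.pt := congrArg FlowHom.toFunP h
  rw [this]
  exact ConePath.isOpenEmbedding_pt.isEmbedding

theorem isEmbedding_attι {Y : Flow} {n : ℕ} {J : Type}
    (a : J → FlowHom (Glob (diskBoundary n)) Y) : Topology.IsEmbedding (attι a).toFunP :=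
  isEmbedding_of_cone _ (coneAtt a (coneIn Y)) (coneAtt_ι _ _)

variable (X : Flow)

theorem isEmbedding_skι (n : ℕ) : Topology.IsEmbedding (skι X n).toFunP :=
  isEmbedding_attι (skAtt X n)

/-- extend to higher skeleta -/
noncomputable def coneTower (n : ℕ) : ∀ i, FlowHom (sk X (n + i)) (coneFlow (sk X n))
  | 0 => coneIn (sk X n)
  | i + 1 => coneAtt (skAtt X (n + i)) (coneTower n i)

theorem coneTower_ι (n i : ℕ) :
    FlowHom.comp (X := sk X (n + i)) (Y := sk X (n + i + 1)) (coneTower X n (i + 1))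
      (skι X (n + i)) = coneTower X n i :=
  coneAtt_ι _ _

theorem coneTower_skle (n i : ℕ) (h : n ≤ n + i) :
    (coneTower X n i).comp (skle X h) = coneIn (sk X n) := by
  induction i with
  | zero => 
    have : skle X h = FlowHom.id _ := skle_refl X n
    rw [this]; rfl
  | succ i ih =>
    have e : skle X h = (skι X (n + i)).comp (skle X (Nat.le_add_right n i)) := by
      rw [← skle_succ X (n + i) (Nat.le_succ _), ← skle_trans]
    rw [e, ← FlowHom.comp_assoc]
    rw [← ih (Nat.le_add_right n i)]
    exact congrArg (fun q => FlowHom.comp q (skle X (Nat.le_add_right n i))) (coneTower_ι X n i)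

theorem isEmbedding_incl (n : ℕ) : Topology.IsEmbedding (resIncl X n).toFunP := by
  obtain ⟨r, hr, -⟩ := res_isColimit X (coneFlow (sk X n))
    (fun j => (coneTower X n j).comp (skle X (Nat.le_add_left j n))) (by
      intro j
      rw [FlowHom.comp_assoc, ← skle_succ X j (Nat.le_succ j), ← skle_trans]
      have e : skle X ((Nat.le_succ j).trans (Nat.le_add_left (j + 1) n)) =
          (skι X (n + j)).comp (skle X (Nat.le_add_left j n)) := by
        rw [← skle_succ X (n + j) (Nat.le_succ _), ← skle_trans]
      rw [e, ← FlowHom.comp_assoc]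
      exact congrArg (fun q => FlowHom.comp q (skle X (Nat.le_add_left j n))) (coneTower_ι X n j))
  exact isEmbedding_of_cone _ r ((hr n).trans (coneTower_skle X n n _))

end

section
/-! ### compact subsets lie in a finite stage -/

/-- naturals with maximum -/
def depthFlow : Flow := oneFlow NLow (fun a b => ⟨max a.val b.val⟩)
  (continuous_op_NLow max fun _ _ _ _ h h' => max_le_max h h')
  (fun a b c => by rw [max_assoc])

open Classical in
/-- extension of a depth function over a cell -/
noncomputable def depthFun {n : ℕ} (f : diskBoundary n → NLow) (j : ℕ) (ρ : ℝ)
    (y : closedDisk n) : NLow :=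
  if h : ρ < ‖(y : EuclideanSpace ℝ (Fin n))‖ ∧ (y : EuclideanSpace ℝ (Fin n)) ≠ 0 then
    f (dir _ h.2) else ⟨j⟩

theorem depthFun_le {n : ℕ} (f : diskBoundary n → NLow) (j : ℕ) (ρ : ℝ) (hf : ∀ y, (f y).val ≤ j)
    (y : closedDisk n) : (depthFun f j ρ y).val ≤ j := by
  unfold depthFun
  split_ifs
  · exact hf _
  · exact le_refl _

theorem depthFun_small {n : ℕ} (f : diskBoundary n → NLow) (j : ℕ) (ρ : ℝ)
    (y : closedDisk n) (hy : ‖(y : EuclideanSpace ℝ (Fin n))‖ ≤ ρ) : depthFun f j ρ y = ⟨j⟩ :=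
  dif_neg fun h => absurd h.1 (not_lt.2 hy)

theorem depthFun_bdry {n : ℕ} (f : diskBoundary n → NLow) (j : ℕ) (ρ : ℝ) (hρ : ρ < 1)
    (y : diskBoundary n) : depthFun f j ρ (diskBoundaryInclusion n y) = f y := by
  have h : ρ < ‖((diskBoundaryInclusion n y : closedDisk n) : EuclideanSpace ℝ (Fin n))‖ ∧
     ((diskBoundaryInclusion n y : closedDisk n) : EuclideanSpace ℝ (Fin n)) ≠ 0 :=
    ⟨by rw [norm_bdry]; exact hρ, bdry_ne_zero y⟩
  exact (dif_pos h).trans (congrArg f (dir_bdry y _))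

theorem continuous_depthFun {n : ℕ} (f : diskBoundary n → NLow) (hc : Continuous f) (j : ℕ) (ρ : ℝ)
    (hf : ∀ y, (f y).val ≤ j) : Continuous (depthFun f j ρ) := by
  refine continuous_NLow (fun y => (depthFun f j ρ y).val) fun r => ?_
  by_cases hr : j ≤ r
  · convert isOpen_univ
    exact Set.eq_univ_of_forall fun y => (depthFun_le f j ρ hf y).trans hr
  · have h1 := isOpen_dir ((isOpen_NLow r).preimage hc)
    have h2 : IsOpen {y : closedDisk n | ρ < ‖(y : EuclideanSpace ℝ (Fin n))‖} :=
      isOpen_lt continuous_const continuous_subtype_val.norm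
    convert h1.inter h2 using 1
    ext y
    constructor
    · intro hy
      change (depthFun f j ρ y).val ≤ r at hy
      unfold depthFun at hy
      split_ifs at hy with h
      · exact ⟨⟨h.2, hy⟩, h.1⟩
      · exact absurd hy hr
    · rintro ⟨⟨h, hy⟩, h'⟩
      change (depthFun f j ρ y).val ≤ r
      unfold depthFun
      rw [dif_pos ⟨h', h⟩]
      exact hy

section
variable (X : Flow)

/-- one more stage -/
noncomputable def depthStep {Y : Flow} {n : ℕ} {J : Type}
    (a : J → FlowHom (Glob (diskBoundary n)) Y) (g : FlowHom Y depthFlow) (j : ℕ) (ρ : ℝ)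
    (hρ : ρ < 1) (hg : ∀ y, (g.toFunP y : NLow).val ≤ j) : FlowHom (Attach a) depthFlow :=
  attDesc g (fun i => globHom (Z := depthFlow) PUnit.unit PUnit.unit
    ⟨depthFun (fun y => g.toFunP ((a i).toFunP y)) j ρ,
      continuous_depthFun _ (g.continuous_toFunP.comp (a i).continuous_toFunP) j ρ
        (fun _ => hg _)⟩ (fun _ => rfl) (fun _ => rfl))
    (fun i => FlowHom.ext (funext fun _ => rfl) (funext fun c => depthFun_bdry (fun y => g.toFunP ((a i).toFunP y)) j ρ hρ c))

theorem depthStep_le {Y : Flow} {n : ℕ} {J : Type}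
    (a : J → FlowHom (Glob (diskBoundary n)) Y) (g : FlowHom Y depthFlow) (j : ℕ) (ρ : ℝ)
    (hρ : ρ < 1) (hg : ∀ y, (g.toFunP y : NLow).val ≤ j) (x : (Attach a).Path) :
    ((depthStep a g j ρ hρ hg).toFunP x : NLow).val ≤ j := by
  induction x using att_ind with
  | hι y => exact hg y
  | hcell i c => exact depthFun_le _ _ _ (fun _ => hg _) c
  | hc x y h hx hy =>
    have := (depthStep a g j ρ hρ hg).comp_map x y h rfl
    rw [this]
    exact max_le hx hy

theorem depthStep_rep {Y : Flow} {n : ℕ} {J : Type}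
    (a : J → FlowHom (Glob (diskBoundary n)) Y) (g : FlowHom Y depthFlow) (j : ℕ) (ρ : ℝ)
    (hρ : ρ < 1) (hg : ∀ y, (g.toFunP y : NLow).val ≤ j) {x : (Attach a).Path}
    {l : List (closedDisk n)} (h : Rep a x l) (c : closedDisk n) (hc : c ∈ l)
    (hcρ : ‖(c : EuclideanSpace ℝ (Fin n))‖ ≤ ρ) :
    j ≤ ((depthStep a g j ρ hρ hg).toFunP x : NLow).val := by
  induction h with
  | base y => simp at hc
  | cell i c' =>
    obtain rfl : c = c' := by simpa using hc
    exact le_of_eq (congrArg NLow.val (depthFun_small (fun y => g.toFunP ((a i).toFunP y)) j ρ c hcρ)).symm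
  | comp x y h l l' hx hy ihx ihy =>
    have := (depthStep a g j ρ hρ hg).comp_map x y h rfl
    rw [this]
    rcases List.mem_append.1 hc with hc | hc
    · exact le_max_of_le_left (ihx hc)
    · exact le_max_of_le_right (ihy hc)

/-- the depth morphisms -/
noncomputable def depth (ρ : ℕ → ℝ) (hρ : ∀ j, ρ j < 1) :
    ∀ j, {d : FlowHom (sk X j) depthFlow // ∀ x, (d.toFunP x : NLow).val ≤ j}
  | 0 => ⟨{ toFun0 := fun _ => PUnit.unit
            toFunP := fun x => ((isEmpty_sk_zero X).false x).elim
            continuous_toFunP := by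
              have := isEmpty_sk_zero X
              exact continuous_of_isEmpty _
            s_map := fun _ => rfl
            t_map := fun _ => rfl
            comp_map := fun x => ((isEmpty_sk_zero X).false x).elim },
          fun x => ((isEmpty_sk_zero X).false x).elim⟩
  | j + 1 => ⟨depthStep (skAtt X j) (depth ρ hρ j).1 j (ρ j) (hρ j) (depth ρ hρ j).2,
      fun x => (depthStep_le (skAtt X j) (depth ρ hρ j).1 j (ρ j) (hρ j) (depth ρ hρ j).2 x).trans
        (Nat.le_succ j)⟩

theorem finite_stage {K : Type*} [TopologicalSpace K] [CompactSpace K] (f : C(K, (Res X).Path)) :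
    ∃ n, ∀ x, f x ∈ Set.range (resIncl X n).toFunP := by
  by_contra! hcon
  let P : ℕ → ℝ → Prop := fun j r => ∃ (x : K) (w : (sk X (j + 1)).Path)
    (l : List (closedDisk j)) (c : closedDisk j), f x = (resIncl X (j + 1)).toFunP w ∧
      Rep (skAtt X j) w l ∧ c ∈ l ∧ ‖(c : EuclideanSpace ℝ (Fin j))‖ = r ∧ r < 1
  have hex : ∀ j, ∃ r : ℝ, r < 1 ∧ ((∃ r', P j r') → P j r) := by
    intro j
    by_cases h : ∃ r', P j r'
    · obtain ⟨r, hr⟩ := h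
      refine ⟨r, ?_, fun _ => hr⟩
      obtain ⟨_, _, _, _, _, _, _, _, h⟩ := hr
      exact h
    · exact ⟨0, one_pos, fun h' => absurd h' h⟩
  choose ρ hρ hP using hex
  obtain ⟨F, hF, -⟩ := res_isColimit X depthFlow (fun j => (depth X ρ hρ j).1)
    (fun j => attDesc_ι (a := skAtt X j) _ _ _)
  have hcont : Continuous (fun x : K => (F.toFunP (f x) : NLow)) :=
    F.continuous_toFunP.comp f.continuous
  have hbd : ∃ R : ℕ, ∀ x, (F.toFunP (f x) : NLow).val ≤ R := by
    have hU := isCompact_univ.elim_directed_cover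
      (fun r : ℕ => {x : K | (F.toFunP (f x) : NLow).val ≤ r})
      (fun r => (isOpen_NLow r).preimage hcont)
      (fun x _ => Set.mem_iUnion.2 ⟨_, le_refl (F.toFunP (f x) : NLow).val⟩)
      (directed_of_isDirected_le fun r r' h x hx => le_trans hx h)
    obtain ⟨R, hR⟩ := hU
    exact ⟨R, fun x => hR (Set.mem_univ x)⟩
  obtain ⟨R, hR⟩ := hbd
  obtain ⟨x, hx⟩ := hcon (R + 1)
  classical
  have hm := res_exists X (f x)
  have h1 := Nat.find_spec hm
  have h2 : R + 1 < Nat.find hm := by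
    by_contra! h
    exact hx (range_incl_mono X h h1)
  obtain ⟨j, hj⟩ : ∃ j, Nat.find hm = j + 1 := ⟨Nat.find hm - 1, by omega⟩
  have h3 : f x ∉ Set.range (resIncl X j).toFunP := Nat.find_min hm (by omega)
  rw [hj] at h1
  obtain ⟨w, hw⟩ := h1
  obtain ⟨l, hl⟩ := exists_rep (a := skAtt X j) w
  have h4 : ∃ c ∈ l, ‖(c : EuclideanSpace ℝ (Fin j))‖ ≠ 1 := by
    by_contra! h
    obtain ⟨y, hy⟩ := hl.mem_range h
    refine h3 ⟨y, ?_⟩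
    rw [← hw, ← resIncl_ι]
    exact congrArg (resIncl X (j + 1)).toFunP hy
  obtain ⟨c, hc, hc1⟩ := h4
  have hc2 : ‖(c : EuclideanSpace ℝ (Fin j))‖ ≤ 1 := mem_closedBall_zero_iff.1 c.2
  obtain ⟨x', w', l', c', e1, e2, e3, e4, e5⟩ := hP j ⟨_, x, w, l, c, hw.symm, hl, hc, rfl,
    lt_of_le_of_ne hc2 hc1⟩
  have h5 := depthStep_rep (skAtt X j) (depth X ρ hρ j).1 j (ρ j) (hρ j) (depth X ρ hρ j).2 e2 c' e3
    (le_of_eq e4)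
  have h6 := hR x'
  have h7 : F.toFunP (f x') = (depth X ρ hρ (j + 1)).1.toFunP w' := by
    rw [e1]
    exact FlowHom.congrP (hF (j + 1)) w'
  rw [h7] at h6
  have h8 := le_trans h5 h6
  omega

theorem finite_stage_lift {K : Type*} [TopologicalSpace K] [CompactSpace K]
    (f : C(K, (Res X).Path)) :
    ∃ n, ∃ g : C(K, (sk X n).Path), ∀ x, (resIncl X n).toFunP (g x) = f x := by
  obtain ⟨n, hn⟩ := finite_stage X f
  choose g hg using hn
  refine ⟨n, ⟨g, ?_⟩, hg⟩
  rw [(isEmbedding_incl X n).continuous_iff]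
  exact f.continuous.congr fun x => (hg x).symm

end

end

section
/-! ### general position -/

/-- maps from `K` to an `m`-dimensional space can be pushed off points -/
def Thin (K : Type) [TopologicalSpace K] (m : ℕ) : Prop :=
  ∀ (v : C(K, EuclideanSpace ℝ (Fin m))) (ε : ℝ), 0 < ε →
    ∃ g : C(K, EuclideanSpace ℝ (Fin m)), (∀ x, dist (g x) (v x) < ε) ∧ Dense (Set.range g)ᶜ

theorem thin_sphere (k m : ℕ) (h : k ≤ m) : Thin (diskBoundary k) m := by
  intro v ε hε
  obtain ⟨w, hw⟩ := v.exists_extension' (e := ((↑) : diskBoundary k → EuclideanSpace ℝ (Fin k)))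
    Metric.isClosed_sphere.isClosedEmbedding_subtypeVal
  obtain ⟨g, hg, hgw, -⟩ := w.continuous.exists_contDiff_approx 1 (ε := fun _ => ε)
    continuous_const (fun _ => hε)
  refine ⟨⟨fun x => g x, hg.continuous.comp continuous_subtype_val⟩, fun x => ?_, ?_⟩
  · rw [← hw]
    exact hgw x
  · have hr : Set.range (fun x : diskBoundary k => g x) = g '' (Metric.sphere 0 1) := by
      rw [Set.image_eq_range]
    change Dense (Set.range (fun x : diskBoundary k => g x))ᶜ
    rw [hr]
    rcases h.lt_or_eq with h | h
    · have := ContDiff.dense_compl_range_of_finrank_lt_finrank (f := g) hg (by simpa using h)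
      exact this.mono (Set.compl_subset_compl.2 (Set.image_subset_range _ _))
    · subst h
      have h1 : MeasureTheory.volume (g '' (Metric.sphere 0 1)) = 0 :=
        MeasureTheory.addHaar_image_eq_zero_of_differentiableOn_of_addHaar_eq_zero _
          (hg.differentiable (by simp)).differentiableOn
          (MeasureTheory.Measure.addHaar_sphere_of_ne_zero _ _ one_ne_zero)
      have := MeasureTheory.Measure.dense_of_ae (μ := MeasureTheory.volume)
        (p := fun y => y ∈ (g '' (Metric.sphere 0 1))ᶜ) (MeasureTheory.compl_mem_ae_iff.2 h1)
      exact this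

theorem general_position {K : Type} [TopologicalSpace K] [CompactSpace K] {m : ℕ} (hK : Thin K m)
    {A : Type} [Finite A] (e : A → C(K, EuclideanSpace ℝ (Fin m))) (ε : ℝ) (hε : 0 < ε) :
    ∃ τ : C(K, EuclideanSpace ℝ (Fin m)), (∀ x, ‖τ x‖ < ε) ∧ ∀ a x, τ x + e a x ≠ 0 := by
  have h := dense_iInter_of_isOpen (f := fun a : A => {τ : C(K, EuclideanSpace ℝ (Fin m)) |
    ∀ x, τ x + e a x ≠ 0}) ?_ ?_
  · obtain ⟨τ, h1, h2⟩ := h.exists_dist_lt 0 hε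
    refine ⟨τ, fun x => ?_, fun a x => Set.mem_iInter.1 h1 a x⟩
    rw [dist_eq_norm, zero_sub, norm_neg] at h2
    exact lt_of_le_of_lt (τ.norm_coe_le_norm x) h2
  · intro a
    have h1 : Continuous fun τ : C(K, EuclideanSpace ℝ (Fin m)) => τ + e a :=
      continuous_id.add continuous_const
    have h2 := (ContinuousMap.isOpen_setOfPred_mapsTo (X := K) (Y := EuclideanSpace ℝ (Fin m))
      isCompact_univ (isOpen_compl_singleton (x := 0))).preimage h1
    convert h2 using 1
    ext τ
    constructor
    · intro h x _
      exact h x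
    · intro h x
      exact h (Set.mem_univ x)
  · intro a
    rw [Metric.dense_iff]
    intro τ r hr
    obtain ⟨g, hg, hd⟩ := hK (τ + e a) (r / 4) (by positivity)
    obtain ⟨z, hz, hz'⟩ := hd.exists_dist_lt 0 (show 0 < r / 4 by positivity)
    rw [dist_eq_norm, zero_sub, norm_neg] at hz'
    refine ⟨g - ContinuousMap.const K z - e a, ?_, ?_⟩
    · rw [Metric.mem_ball]
      refine lt_of_le_of_lt ((ContinuousMap.dist_le (show 0 ≤ r / 2 by positivity)).2 ?_)
        (by linarith)
      intro x
      have h1 := hg x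
      rw [dist_eq_norm] at h1 ⊢
      have h2 : (g - ContinuousMap.const K z - e a) x - τ x = (g x - (τ + e a) x) - z := by
        simp only [ContinuousMap.sub_apply, ContinuousMap.const_apply, ContinuousMap.add_apply]
        abel
      rw [h2]
      have := norm_sub_le (g x - (τ + e a) x) z
      linarith
    · intro x hx
      refine hz ⟨x, ?_⟩
      simp only [ContinuousMap.sub_apply, ContinuousMap.const_apply, sub_add_cancel] at hx
      exact sub_eq_zero.1 hx

end

section
/-! ### detecting small letters -/

section lists
variable {D : Type}

/-- elementary relation of a letter -/
def letRel (W : ℕ → Set D) (c : D) (i j : ℕ) : Prop := i = j ∨ (j = i + 1 ∧ c ∈ W i)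

/-- composition of relations on naturals -/
def relOp (R S : ℕ → ℕ → Prop) (i k : ℕ) : Prop := ∃ j, R i j ∧ S j k

/-- the relation of a word -/
def wordRel (W : ℕ → Set D) (l : List D) : ℕ → ℕ → Prop :=
  l.foldr (fun c m => relOp (letRel W c) m) (fun i j => i = j)

theorem wordRel_cons (W : ℕ → Set D) (c : D) (l : List D) (i k : ℕ) :
    wordRel W (c :: l) i k ↔ wordRel W l i k ∨ (c ∈ W i ∧ wordRel W l (i + 1) k) := by
  constructor
  · rintro ⟨j, rfl | ⟨rfl, hc⟩, h⟩
    · exact Or.inl h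
    · exact Or.inr ⟨hc, h⟩
  · rintro (h | ⟨hc, h⟩)
    · exact ⟨i, Or.inl rfl, h⟩
    · exact ⟨i + 1, Or.inr ⟨rfl, hc⟩, h⟩

theorem wordRel_imp (W : ℕ → Set D) (p : D → Prop) [DecidablePred p] (hW : ∀ i, ∀ c ∈ W i, p c)
    (l : List D) (k : ℕ) : ∀ i, wordRel W l i k → i ≤ k ∧ k ≤ i + (l.filter p).length ∧
      (i + (l.filter p).length ≤ k → ∀ j d, j < (l.filter p).length →
        (l.filter p).getD j d ∈ W (i + j)) := by
  induction l with
  | nil =>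
    intro i h
    obtain rfl : i = k := h
    simp
  | cons c l ih =>
    intro i h
    rcases (wordRel_cons W c l i k).1 h with h | ⟨hc, h⟩
    · obtain ⟨h1, h2, h3⟩ := ih i h
      by_cases hp : p c
      · rw [List.filter_cons_of_pos (by simpa using hp), List.length_cons]
        refine ⟨h1, by omega, fun h4 => by omega⟩
      · rw [List.filter_cons_of_neg (by simpa using hp)]
        exact ⟨h1, h2, h3⟩
    · obtain ⟨h1, h2, h3⟩ := ih (i + 1) h
      rw [List.filter_cons_of_pos (by simpa using hW i c hc), List.length_cons]
      refine ⟨by omega, by omega, fun h4 j d hj => ?_⟩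
      rcases j with _ | j
      · simpa using hc
      · have := h3 (by omega) j d (by omega)
        rw [List.getD_cons_succ, show i + (j + 1) = i + 1 + j by omega]
        exact this

theorem wordRel_of (W : ℕ → Set D) (p : D → Prop) [DecidablePred p] (d : D)
    (l : List D) : ∀ i, (∀ j, j < (l.filter p).length → (l.filter p).getD j d ∈ W (i + j)) →
      wordRel W l i (i + (l.filter p).length) := by
  induction l with
  | nil => intro i _; rfl
  | cons c l ih =>
    intro i h
    rw [wordRel_cons]
    by_cases hp : p c
    · rw [List.filter_cons_of_pos (by simpa using hp), List.length_cons] at h ⊢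
      right
      refine ⟨by simpa using h 0 (by omega), ?_⟩
      have := ih (i + 1) (fun j hj => by
        have := h (j + 1) (by omega)
        rw [List.getD_cons_succ, show i + (j + 1) = i + 1 + j by omega] at this
        exact this)
      rw [show i + 1 + (l.filter p).length = i + ((l.filter p).length + 1) by omega] at this
      exact this
    · rw [List.filter_cons_of_neg (by simpa using hp)] at h ⊢
      exact Or.inl (ih i h)

end lists

open Classical in
/-- the small letters of a word -/
noncomputable def smalls {n : ℕ} (σ : ℝ) (l : List (closedDisk n)) : List (closedDisk n) :=
  l.filter (fun c : closedDisk n => ‖(c : EuclideanSpace ℝ (Fin n))‖ ≤ σ)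

theorem smalls_pos {n : ℕ} (σ : ℝ) (c : closedDisk n) (l : List (closedDisk n))
    (h : ‖(c : EuclideanSpace ℝ (Fin n))‖ ≤ σ) : smalls σ (c :: l) = c :: smalls σ l :=
  List.filter_cons_of_pos (by simpa using h)

theorem smalls_neg {n : ℕ} (σ : ℝ) (c : closedDisk n) (l : List (closedDisk n))
    (h : ¬ ‖(c : EuclideanSpace ℝ (Fin n))‖ ≤ σ) : smalls σ (c :: l) = smalls σ l :=
  List.filter_cons_of_neg (by simpa using h)

theorem mem_smalls {n : ℕ} (σ : ℝ) (c : closedDisk n) (l : List (closedDisk n)) :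
    c ∈ smalls σ l ↔ c ∈ l ∧ ‖(c : EuclideanSpace ℝ (Fin n))‖ ≤ σ := by
  simp [smalls]

theorem continuous_relOp :
    Continuous fun p : (ℕ → ℕ → Prop) × (ℕ → ℕ → Prop) => relOp p.1 p.2 := by
  refine continuous_pi fun i => continuous_pi fun k => ?_
  rw [continuous_Prop]
  have : {p : (ℕ → ℕ → Prop) × (ℕ → ℕ → Prop) | relOp p.1 p.2 i k} =
      ⋃ j, ({p | p.1 i j} ∩ {p | p.2 j k}) := by
    ext p
    simp [relOp]
  rw [this]
  refine isOpen_iUnion fun j => IsOpen.inter ?_ ?_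
  · exact continuous_Prop.1 ((continuous_apply j).comp ((continuous_apply i).comp continuous_fst))
  · exact continuous_Prop.1 ((continuous_apply k).comp ((continuous_apply j).comp continuous_snd))

section
variable {Y : Flow} {n : ℕ} {J : Type} (a : J → FlowHom (Glob (diskBoundary n)) Y)
variable {K : Type} [TopologicalSpace K] (f : C(K, (Attach a).Path))
  (w : K → List (closedDisk n))

theorem isOpen_wordRel (hw : ∀ x, Rep a (f x) (w x)) (W : ℕ → Set (closedDisk n)) (hW : ∀ i, IsOpen (W i))
    (hb : ∀ i, ∀ c ∈ W i, ‖(c : EuclideanSpace ℝ (Fin n))‖ ≠ 1) (i k : ℕ) :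
    IsOpen {x : K | wordRel W (w x) i k} := by
  have hassoc : ∀ R S T : ℕ → ℕ → Prop, relOp R (relOp S T) = relOp (relOp R S) T := by
    intro R S T
    funext i k
    apply propext
    constructor
    · rintro ⟨j, h1, j', h2, h3⟩
      exact ⟨j', ⟨j, h1, h2⟩, h3⟩
    · rintro ⟨j', ⟨j, h1, h2⟩, h3⟩
      exact ⟨j, h1, j', h2, h3⟩
  have he : ∀ R : ℕ → ℕ → Prop, relOp (fun i j => i = j) R = R := by
    intro R
    funext i k
    apply propext
    constructor
    · rintro ⟨j, h, h'⟩
      subst h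
      exact h'
    · intro h
      exact ⟨i, rfl, h⟩
  have he' : ∀ R : ℕ → ℕ → Prop, relOp R (fun i j => i = j) = R := by
    intro R
    funext i k
    apply propext
    constructor
    · rintro ⟨j, h, h'⟩
      subst h'
      exact h
    · intro h
      exact ⟨k, h, rfl⟩
  have hφ : Continuous (letRel W : closedDisk n → ℕ → ℕ → Prop) := by
    refine continuous_pi fun i => continuous_pi fun k => ?_
    rw [continuous_Prop]
    by_cases h1 : i = k
    · convert isOpen_univ
      exact Set.eq_univ_of_forall fun c => Or.inl h1
    · by_cases h2 : k = i + 1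
      · convert hW i using 1
        ext c
        constructor
        · rintro (h | h)
          · exact absurd h h1
          · exact h.2
        · intro h
          exact Or.inr ⟨h2, h⟩
      · convert isOpen_empty
        refine Set.eq_empty_of_forall_notMem ?_
        rintro c (h | h)
        · exact h1 h
        · exact h2 h.1
  have hb' : ∀ c : closedDisk n, ‖(c : EuclideanSpace ℝ (Fin n))‖ = 1 →
      letRel W c = fun i j => i = j := by
    intro c hc
    funext i j
    apply propext
    constructor
    · rintro (h | h)
      · exact h
      · exact absurd hc (hb _ _ h.2)
    · intro h
      exact Or.inl h
  let H := letterHom a (ℕ → ℕ → Prop) relOp continuous_relOp hassoc (fun i j => i = j) he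
    (letRel W) hφ hb'
  have hH : ∀ x, (H.toFunP (f x) : ℕ → ℕ → Prop) = wordRel W (w x) := fun x =>
    letterHom_rep a (ℕ → ℕ → Prop) relOp continuous_relOp hassoc (fun i j => i = j) he he'
    (letRel W) hφ hb' (hw x)
  have hc : Continuous fun x => wordRel W (w x) :=
    (H.continuous_toFunP.comp f.continuous).congr hH
  exact continuous_Prop.1 ((continuous_apply k).comp ((continuous_apply i).comp hc))

theorem isOpen_count (hw : ∀ x, Rep a (f x) (w x)) (σ : ℝ) (hσ : σ < 1) (r : ℕ) :
    IsOpen {x : K | (smalls σ (w x)).length ≤ r} := by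
  let φ : closedDisk n → ℕ := fun c => if ‖(c : EuclideanSpace ℝ (Fin n))‖ ≤ σ then 1 else 0
  have hφ : Continuous fun c => NLow.mk (φ c) := by
    refine continuous_NLow _ fun r => ?_
    rcases r with _ | r
    · have : IsOpen {c : closedDisk n | σ < ‖(c : EuclideanSpace ℝ (Fin n))‖} :=
        isOpen_lt continuous_const continuous_subtype_val.norm
      convert this using 1
      ext c
      simp [φ]
    · convert isOpen_univ
      refine Set.eq_univ_of_forall fun c => ?_
      show φ c ≤ r + 1
      simp only [φ]
      split_ifs <;> omega
  have hop := continuous_op_NLow (· + ·) fun _ _ _ _ h h' => add_le_add h h'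
  have hassoc : ∀ x y z : NLow, (⟨x.val + (y.val + z.val)⟩ : NLow) = ⟨x.val + y.val + z.val⟩ :=
    fun x y z => by rw [add_assoc]
  have hb : ∀ c : closedDisk n, ‖(c : EuclideanSpace ℝ (Fin n))‖ = 1 →
      NLow.mk (φ c) = ⟨0⟩ := by
    intro c hc
    simp only [φ, hc]
    rw [if_neg (not_le.2 hσ)]
  let H := letterHom a NLow (fun x y => ⟨x.val + y.val⟩) hop hassoc ⟨0⟩
    (fun x => by simp) (fun c => ⟨φ c⟩) hφ hb
  have hH : ∀ x, (H.toFunP (f x) : NLow) = ⟨(smalls σ (w x)).length⟩ := by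
    intro x
    refine (letterHom_rep a NLow (fun x y => ⟨x.val + y.val⟩) hop hassoc ⟨0⟩
      (fun x => by simp) (fun x => by simp) (fun c => ⟨φ c⟩) hφ hb (hw x)).trans ?_
    generalize w x = l
    have key : (l.foldr (fun c m => (⟨φ c + m.val⟩ : NLow)) ⟨0⟩).val = (smalls σ l).length := by
      induction l with
      | nil => rfl
      | cons c l ih =>
        rw [List.foldr_cons, ih]
        by_cases h : ‖(c : EuclideanSpace ℝ (Fin n))‖ ≤ σ
        · rw [smalls_pos σ c l h, List.length_cons]
          simp only [φ, if_pos h]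
          rw [add_comm]
        · rw [smalls_neg σ c l h]
          simp only [φ, if_neg h, zero_add]
    exact congrArg NLow.mk key
  have hc : Continuous fun x => NLow.mk (smalls σ (w x)).length :=
    (H.continuous_toFunP.comp f.continuous).congr hH
  exact (isOpen_NLow r).preimage hc

end

end

section
section
variable {Y : Flow} {n : ℕ} {J : Type} (a : J → FlowHom (Glob (diskBoundary n)) Y)

theorem exists_small (l : List (closedDisk n)) : ∃ σ : ℝ, 0 < σ ∧ σ < 1 ∧
    ∀ c ∈ l, ‖(c : EuclideanSpace ℝ (Fin n))‖ ≤ σ → (c : EuclideanSpace ℝ (Fin n)) = 0 := by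
  induction l with
  | nil => exact ⟨1 / 2, by norm_num, by norm_num, by simp⟩
  | cons c l ih =>
    obtain ⟨σ, h0, h1, h2⟩ := ih
    by_cases hc : (c : EuclideanSpace ℝ (Fin n)) = 0
    · refine ⟨σ, h0, h1, fun d hd h => ?_⟩
      rcases List.mem_cons.1 hd with rfl | hd
      · exact hc
      · exact h2 d hd h
    · have hc' : 0 < ‖(c : EuclideanSpace ℝ (Fin n))‖ := norm_pos_iff.2 hc
      refine ⟨min σ (‖(c : EuclideanSpace ℝ (Fin n))‖ / 2), lt_min h0 (by positivity),
        lt_of_le_of_lt (min_le_left _ _) h1, fun d hd h => ?_⟩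
      rcases List.mem_cons.1 hd with rfl | hd
      · have := h.trans (min_le_right _ _)
        linarith
      · exact h2 d hd (h.trans (min_le_left _ _))

/-- center of the disk -/
def ctr (n : ℕ) : closedDisk n := ⟨0, by simp⟩

theorem local_sections {K : Type} [TopologicalSpace K] [CompactSpace K] [T2Space K]
    (f : C(K, (Attach a).Path)) (w : K → List (closedDisk n)) (hw : ∀ x, Rep a (f x) (w x))
    (x₀ : K) : ∃ (σ : ℝ) (r : ℕ) (C : Set K) (e : Fin r → C(K, EuclideanSpace ℝ (Fin n))),
      0 < σ ∧ C ∈ nhds x₀ ∧ ∀ x ∈ C, ∀ c ∈ w x, ‖(c : EuclideanSpace ℝ (Fin n))‖ ≤ σ →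
        ∃ i, e i x = (1 - ‖(c : EuclideanSpace ℝ (Fin n))‖)⁻¹ • (c : EuclideanSpace ℝ (Fin n)) := by
  classical
  obtain ⟨σ, hσ0, hσ1, hσ⟩ := exists_small (w x₀)
  let r := (smalls σ (w x₀)).length
  let ball : Set (closedDisk n) := {c | ‖(c : EuclideanSpace ℝ (Fin n))‖ < σ}
  have hball : IsOpen ball := isOpen_lt continuous_subtype_val.norm continuous_const
  let W₀ : ℕ → Set (closedDisk n) := fun _ => ball
  have hne : ∀ c ∈ ball, ‖(c : EuclideanSpace ℝ (Fin n))‖ ≠ 1 := fun c hc h => by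
    have : ‖(c : EuclideanSpace ℝ (Fin n))‖ < σ := hc
    linarith
  have hle : ∀ c ∈ ball, ‖(c : EuclideanSpace ℝ (Fin n))‖ ≤ σ := fun c hc => le_of_lt hc
  let N : Set K := {x | (smalls σ (w x)).length ≤ r} ∩ {x | wordRel W₀ (w x) 0 r}
  have hNo : IsOpen N := (isOpen_count a f w hw σ hσ1 r).inter
    (isOpen_wordRel a f w hw W₀ (fun _ => hball) (fun _ => hne) 0 r)
  have hN0 : x₀ ∈ N := by
    refine ⟨le_refl r, ?_⟩
    have := wordRel_of W₀ (fun c : closedDisk n => ‖(c : EuclideanSpace ℝ (Fin n))‖ ≤ σ) (ctr n)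
      (w x₀) 0 (fun j hj => ?_)
    · rw [zero_add] at this
      exact this
    · have h1 : (smalls σ (w x₀)).getD j (ctr n) ∈ smalls σ (w x₀) := by
        rw [List.getD_eq_getElem (smalls σ (w x₀)) _ hj]
        exact List.getElem_mem _
      have h2 := (mem_smalls _ _ _).1 h1
      have h3 := hσ _ h2.1 h2.2
      show ‖((smalls σ (w x₀)).getD j (ctr n) : EuclideanSpace ℝ (Fin n))‖ < σ
      rw [h3]
      simpa using hσ0
  have hprop : ∀ (W : ℕ → Set (closedDisk n)), (∀ i, W i ⊆ ball) → ∀ x,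
      (smalls σ (w x)).length ≤ r → wordRel W (w x) 0 r → (smalls σ (w x)).length = r ∧
        ∀ j, j < r → (smalls σ (w x)).getD j (ctr n) ∈ W j := by
    intro W hW x h1 h2
    obtain ⟨-, h4, h5⟩ := wordRel_imp W
      (fun c : closedDisk n => ‖(c : EuclideanSpace ℝ (Fin n))‖ ≤ σ)
      (fun i c hc => hle c (hW i hc)) (w x) r 0 h2
    rw [zero_add] at h4 h5
    have h6 : (smalls σ (w x)).length = r := le_antisymm h1 h4
    refine ⟨h6, fun j hj => ?_⟩
    have := h5 h1 j (ctr n) (by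
      change j < (smalls σ (w x)).length
      rw [h6]; exact hj)
    rw [zero_add] at this
    exact this
  have hcont : ∀ i : Fin r, ContinuousOn (fun x => (smalls σ (w x)).getD i (ctr n)) N := by
    intro i
    refine continuousOn_iff_continuous_domRestrict.2 ?_
    rw [continuous_iff_continuousAt]
    rintro ⟨x, hx⟩
    refine tendsto_nhds.2 fun O hO hxO => ?_
    let W : ℕ → Set (closedDisk n) := fun j => if j = i then ball ∩ O else ball
    have hWo : ∀ j, IsOpen (W j) := by
      intro j
      simp only [W]
      split_ifs
      · exact hball.inter hO
      · exact hball
    have hWb : ∀ j, W j ⊆ ball := by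
      intro j
      simp only [W]
      split_ifs
      · exact Set.inter_subset_left
      · exact subset_rfl
    have hopen := isOpen_wordRel a f w hw W hWo (fun j c hc => hne c (hWb j hc)) 0 r
    have hxN := hprop W₀ (fun _ => subset_rfl) x hx.1 hx.2
    have hxW : wordRel W (w x) 0 r := by
      have := wordRel_of W (fun c : closedDisk n => ‖(c : EuclideanSpace ℝ (Fin n))‖ ≤ σ) (ctr n)
        (w x) 0 (fun j hj => ?_)
      · have h7 : 0 + (smalls σ (w x)).length = r := by rw [zero_add]; exact hxN.1
        have h8 : wordRel W (w x) 0 (0 + (smalls σ (w x)).length) := this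
        rw [h7] at h8
        exact h8
      · have hj' : j < r := by
          rw [← hxN.1]; exact hj
        rw [zero_add]
        have h9 := hxN.2 j hj'
        simp only [W]
        split_ifs with h
        · subst h
          exact ⟨h9, hxO⟩
        · exact h9
    have : {y : N | wordRel W (w y) 0 r} ∈ nhds (⟨x, hx⟩ : N) :=
      (hopen.preimage continuous_subtype_val).mem_nhds hxW
    refine Filter.mem_of_superset this ?_
    rintro ⟨y, hy⟩ hyW
    have h10 := (hprop W hWb y hy.1 hyW).2 i i.2
    simp only [W, if_true] at h10
    exact h10.2
  obtain ⟨C, hC, hCc, hCN⟩ := exists_mem_nhds_isClosed_subset (hNo.mem_nhds hN0)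
  have hext : ∀ i : Fin r, ∃ e : C(K, EuclideanSpace ℝ (Fin n)), ∀ x ∈ C,
      e x = (1 - ‖((smalls σ (w x)).getD i (ctr n) : EuclideanSpace ℝ (Fin n))‖)⁻¹ •
        ((smalls σ (w x)).getD i (ctr n) : EuclideanSpace ℝ (Fin n)) := by
    intro i
    have h11 : Continuous fun x : C =>
        ((smalls σ (w x)).getD i (ctr n) : EuclideanSpace ℝ (Fin n)) :=
      continuous_subtype_val.comp (continuousOn_iff_continuous_domRestrict.1 ((hcont i).mono hCN))
    let g : C(C, EuclideanSpace ℝ (Fin n)) := ⟨fun x : C =>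
      (1 - ‖((smalls σ (w x)).getD i (ctr n) : EuclideanSpace ℝ (Fin n))‖)⁻¹ •
        ((smalls σ (w x)).getD i (ctr n) : EuclideanSpace ℝ (Fin n)), by
      refine Continuous.smul (Continuous.inv₀ (continuous_const.sub h11.norm) ?_) h11
      rintro ⟨x, hx⟩
      have h12 := (hprop W₀ (fun _ => subset_rfl) x (hCN hx).1 (hCN hx).2).2 i i.2
      have h13 : ‖((smalls σ (w x)).getD i (ctr n) : EuclideanSpace ℝ (Fin n))‖ < σ := h12
      exact ne_of_gt (show (0:ℝ) < 1 - ‖((smalls σ (w x)).getD i (ctr n) : EuclideanSpace ℝ (Fin n))‖ by linarith)⟩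
    obtain ⟨e, he⟩ := g.exists_restrict_eq hCc
    refine ⟨e, fun x hx => ?_⟩
    have := congrArg (fun q => q ⟨x, hx⟩) he
    exact this
  choose e he using hext
  refine ⟨σ, r, C, e, hσ0, hC, fun x hx c hc hcσ => ?_⟩
  have h14 : c ∈ smalls σ (w x) := (mem_smalls _ _ _).2 ⟨hc, hcσ⟩
  obtain ⟨j, hj, rfl⟩ := List.getElem_of_mem h14
  have h15 := (hprop W₀ (fun _ => subset_rfl) x (hCN hx).1 (hCN hx).2).1
  refine ⟨⟨j, h15 ▸ hj⟩, ?_⟩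
  rw [he _ x hx]
  simp only
  rw [List.getD_eq_getElem _ _ hj]

end

end

section
section
variable {Y : Flow} {n : ℕ} {J : Type} (a : J → FlowHom (Glob (diskBoundary n)) Y)
variable {K : Type} [TopologicalSpace K] [CompactSpace K]

/-- translation of the disk, fixing the boundary -/
noncomputable def pushG (n : ℕ) (p : closedDisk n × closedDisk n) : closedDisk n :=
  ⟨(p.2 : EuclideanSpace ℝ (Fin n)) + (1 - ‖(p.2 : EuclideanSpace ℝ (Fin n))‖) •
    (p.1 : EuclideanSpace ℝ (Fin n)), by
    rw [mem_closedBall_zero_iff]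
    have h1 : ‖(p.1 : EuclideanSpace ℝ (Fin n))‖ ≤ 1 := mem_closedBall_zero_iff.1 p.1.2
    have h2 : ‖(p.2 : EuclideanSpace ℝ (Fin n))‖ ≤ 1 := mem_closedBall_zero_iff.1 p.2.2
    refine (norm_add_le _ _).trans ?_
    rw [norm_smul, Real.norm_of_nonneg (by linarith)]
    nlinarith⟩

theorem continuous_pushG : Continuous (pushG n) := by
  refine Continuous.subtype_mk ?_ _
  have h1 : Continuous fun p : closedDisk n × closedDisk n => (p.1 : EuclideanSpace ℝ (Fin n)) :=
    continuous_subtype_val.comp continuous_fst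
  have h2 : Continuous fun p : closedDisk n × closedDisk n => (p.2 : EuclideanSpace ℝ (Fin n)) :=
    continuous_subtype_val.comp continuous_snd
  exact h2.add ((continuous_const.sub h2.norm).smul h1)

theorem pushG_bdry (b c : closedDisk n) (hc : ‖(c : EuclideanSpace ℝ (Fin n))‖ = 1) :
    pushG n (b, c) = c := by
  refine Subtype.ext ?_
  simp [pushG, hc]

theorem pushG_ctr (c : closedDisk n) : pushG n (ctr n, c) = c := by
  refine Subtype.ext ?_
  simp [pushG, ctr]

/-- radial stretching -/
noncomputable def stretchG (n : ℕ) (δ : ℝ) (hδ : 0 < δ) (p : unitInterval × closedDisk n) :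
    closedDisk n :=
  ⟨(1 - (p.1 : ℝ) + p.1 * (max δ ‖(p.2 : EuclideanSpace ℝ (Fin n))‖)⁻¹) •
    (p.2 : EuclideanSpace ℝ (Fin n)), by
    rw [mem_closedBall_zero_iff]
    have h2 : ‖(p.2 : EuclideanSpace ℝ (Fin n))‖ ≤ 1 := mem_closedBall_zero_iff.1 p.2.2
    have h3 : 0 < max δ ‖(p.2 : EuclideanSpace ℝ (Fin n))‖ := lt_max_of_lt_left hδ
    have h4 := p.1.2.1
    have h5 := p.1.2.2
    have h6 : (max δ ‖(p.2 : EuclideanSpace ℝ (Fin n))‖)⁻¹ * ‖(p.2 : EuclideanSpace ℝ (Fin n))‖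
      ≤ 1 := by
      rw [inv_mul_le_one₀ h3]
      exact le_max_right _ _
    rw [norm_smul, Real.norm_of_nonneg (by
      have : 0 ≤ (p.1 : ℝ) * (max δ ‖(p.2 : EuclideanSpace ℝ (Fin n))‖)⁻¹ := by positivity
      linarith), add_mul, mul_assoc]
    nlinarith⟩

theorem continuous_stretchG (δ : ℝ) (hδ : 0 < δ) : Continuous (stretchG n δ hδ) := by
  refine Continuous.subtype_mk ?_ _
  have h1 : Continuous fun p : unitInterval × closedDisk n => (p.1 : ℝ) :=
    continuous_subtype_val.comp continuous_fst
  have h2 : Continuous fun p : unitInterval × closedDisk n => (p.2 : EuclideanSpace ℝ (Fin n)) :=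
    continuous_subtype_val.comp continuous_snd
  have h3 : Continuous fun p : unitInterval × closedDisk n =>
      1 - (p.1 : ℝ) + p.1 * (max δ ‖(p.2 : EuclideanSpace ℝ (Fin n))‖)⁻¹ := by
    refine (continuous_const.sub h1).add
      (h1.mul (Continuous.inv₀ (continuous_const.max h2.norm) ?_))
    intro p
    exact ne_of_gt (lt_max_of_lt_left hδ)
  exact h3.smul h2

theorem stretchG_bdry (δ : ℝ) (hδ : 0 < δ) (hδ1 : δ ≤ 1) (b : unitInterval) (c : closedDisk n)
    (hc : ‖(c : EuclideanSpace ℝ (Fin n))‖ = 1) : stretchG n δ hδ (b, c) = c := by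
  refine Subtype.ext ?_
  simp [stretchG, hc, max_eq_right hδ1]

theorem stretchG_zero (δ : ℝ) (hδ : 0 < δ) (c : closedDisk n) : stretchG n δ hδ (0, c) = c := by
  refine Subtype.ext ?_
  simp [stretchG]

theorem stretchG_one (δ : ℝ) (hδ : 0 < δ) (c : closedDisk n)
    (hc : δ < ‖(c : EuclideanSpace ℝ (Fin n))‖) :
    ‖(stretchG n δ hδ (1, c) : EuclideanSpace ℝ (Fin n))‖ = 1 := by
  have : 0 < ‖(c : EuclideanSpace ℝ (Fin n))‖ := hδ.trans hc
  simp only [stretchG, max_eq_right hc.le]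
  rw [norm_smul]
  simp [this.ne']

theorem retract_nonzero (f : C(K, (Attach a).Path)) (w : K → List (closedDisk n))
    (hw : ∀ x, Rep a (f x) (w x))
    (h0 : ∀ x, ∀ c ∈ w x, (c : EuclideanSpace ℝ (Fin n)) ≠ 0) :
    ∃ f1 : C(K, Y.Path), f.Homotopic ((attι a).pathMap.comp f1) := by
  have hδ : ∃ N : ℕ, ∀ x, ∀ c ∈ w x, 1 / ((N : ℝ) + 2) < ‖(c : EuclideanSpace ℝ (Fin n))‖ := by
    have hlt : ∀ N : ℕ, 1 / ((N : ℝ) + 2) < 1 := by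
      intro N
      rw [div_lt_one (by positivity)]
      have : (0 : ℝ) ≤ N := by positivity
      linarith
    have hiff : ∀ (N : ℕ) x, (smalls (1 / ((N : ℝ) + 2)) (w x)).length ≤ 0 ↔
        ∀ c ∈ w x, 1 / ((N : ℝ) + 2) < ‖(c : EuclideanSpace ℝ (Fin n))‖ := by
      intro N x
      rw [Nat.le_zero, List.length_eq_zero_iff, List.eq_nil_iff_forall_not_mem]
      constructor
      · intro h c hc
        by_contra! h'
        exact h c ((mem_smalls _ _ _).2 ⟨hc, h'⟩)
      · intro h c hc
        have := (mem_smalls _ _ _).1 hc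
        exact absurd (h c this.1) (not_lt.2 this.2)
    obtain ⟨N, hN⟩ := isCompact_univ.elim_directed_cover
      (fun N : ℕ => {x : K | (smalls (1 / ((N : ℝ) + 2)) (w x)).length ≤ 0})
      (fun N => isOpen_count a f w hw _ (hlt N) 0)
      (by
        intro x _
        obtain ⟨σ, hσ, -, h2⟩ := exists_small (w x)
        obtain ⟨N, hN⟩ := exists_nat_gt (1 / σ)
        refine Set.mem_iUnion.2 ⟨N, (hiff N x).2 fun c hc => ?_⟩
        by_contra! h
        refine h0 x c hc (h2 c hc (h.trans ?_))
        rw [div_lt_iff₀ hσ] at hN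
        rw [div_le_iff₀ (by positivity)]
        nlinarith)
      (directed_of_isDirected_le fun N N' h x hx => (hiff N' x).2 fun c hc => by
        refine lt_of_le_of_lt ?_ ((hiff N x).1 hx c hc)
        have : (N : ℝ) ≤ N' := by exact_mod_cast h
        exact one_div_le_one_div_of_le (by positivity) (by linarith))
    exact ⟨N, fun x => (hiff N x).1 (hN (Set.mem_univ x))⟩
  obtain ⟨N, hN⟩ := hδ
  generalize hδ' : 1 / ((N : ℝ) + 2) = δ at hN
  have hδ0 : 0 < δ := by rw [← hδ']; positivity
  have hδ1 : δ ≤ 1 := by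
    rw [← hδ', div_le_one (by positivity)]
    have : (0 : ℝ) ≤ N := by positivity
    linarith
  obtain ⟨Φ, hΦ, hΦr, hΦ0⟩ := def_exists a (B := unitInterval) (stretchG n δ hδ0)
    (continuous_stretchG δ hδ0) (stretchG_bdry δ hδ0 hδ1)
  have hr : ∀ x, Φ (1, f x) ∈ Set.range (attι a).toFunP := by
    intro x
    refine (hΦr 1 _ _ (hw x)).mem_range ?_
    intro c hc
    obtain ⟨d, hd, rfl⟩ := List.mem_map.1 hc
    exact stretchG_one δ hδ0 d (hN x d hd)
  choose g hg using hr
  refine ⟨⟨g, ?_⟩, ⟨⟨⟨fun p => Φ (p.1, f p.2), ?_⟩, ?_, ?_⟩⟩⟩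
  · rw [(isEmbedding_attι a).continuous_iff]
    exact (hΦ.comp (Continuous.prodMk continuous_const f.continuous)).congr fun x => (hg x).symm
  · exact hΦ.comp (continuous_fst.prodMk (f.continuous.comp continuous_snd))
  · intro x
    exact hΦ0 0 (stretchG_zero δ hδ0) _
  · intro x
    exact (hg x).symm

theorem step_homotopic [T2Space K] (hK : Thin K n) (f : C(K, (Attach a).Path)) :
    ∃ f1 : C(K, Y.Path), f.Homotopic ((attι a).pathMap.comp f1) := by
  choose w hw using fun x => exists_rep (a := a) (f x)
  choose σ r C e hσ hC hCe using local_sections a f w hw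
  obtain ⟨t, ht⟩ := CompactSpace.elim_nhds_subcover C hC
  have hε : ∃ ε : ℝ, 0 < ε ∧ ε ≤ 1 ∧ ∀ x ∈ t, ε ≤ σ x := by
    clear ht
    classical
    induction t using Finset.induction_on with
    | empty => exact ⟨1, one_pos, le_refl _, by simp⟩
    | insert x t hx ih =>
      obtain ⟨ε, h1, h2, h3⟩ := ih
      refine ⟨min ε (σ x), lt_min h1 (hσ x), (min_le_left _ _).trans h2, ?_⟩
      intro y hy
      rcases Finset.mem_insert.1 hy with rfl | hy
      · exact min_le_right _ _
      · exact (min_le_left _ _).trans (h3 y hy)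
  obtain ⟨ε, hε0, hε1, hε⟩ := hε
  obtain ⟨τ, hτ, hτe⟩ := general_position hK (A := Σ x : t, Fin (r x)) (fun p => e p.1 p.2) ε hε0
  obtain ⟨Φ, hΦ, hΦr, hΦ0⟩ := def_exists a (B := closedDisk n) (pushG n) continuous_pushG pushG_bdry
  have hτ1 : ∀ x, ‖τ x‖ ≤ 1 := fun x => (hτ x).le.trans hε1
  let τ' : unitInterval × K → closedDisk n := fun p => ⟨(p.1 : ℝ) • τ p.2, by
    rw [mem_closedBall_zero_iff, norm_smul, Real.norm_of_nonneg p.1.2.1]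
    have := hτ1 p.2
    have h4 := p.1.2.1
    have h5 := p.1.2.2
    nlinarith [norm_nonneg (τ p.2)]⟩
  have hτ' : Continuous τ' := by
    refine Continuous.subtype_mk ?_ _
    exact (continuous_subtype_val.comp continuous_fst).smul (τ.continuous.comp continuous_snd)
  let f2 : C(K, (Attach a).Path) := ⟨fun x => Φ (τ' (1, x), f x),
    hΦ.comp ((hτ'.comp (Continuous.prodMk continuous_const continuous_id)).prodMk f.continuous)⟩
  obtain ⟨f1, hf1⟩ := retract_nonzero a f2
    (fun x => (w x).map fun c => pushG n (τ' (1, x), c)) (fun x => hΦr _ _ _ (hw x)) (by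
      intro x c hc h0
      obtain ⟨d, hd, rfl⟩ := List.mem_map.1 hc
      have h0' : (d : EuclideanSpace ℝ (Fin n)) + (1 - ‖(d : EuclideanSpace ℝ (Fin n))‖) •
        ((1 : ℝ) • τ x) = 0 := h0
      rw [one_smul] at h0'
      have hd1 : ‖(d : EuclideanSpace ℝ (Fin n))‖ ≤ 1 := mem_closedBall_zero_iff.1 d.2
      have h1 : (d : EuclideanSpace ℝ (Fin n)) = - ((1 - ‖(d : EuclideanSpace ℝ (Fin n))‖) • τ x) :=
        eq_neg_of_add_eq_zero_left h0'
      have h2 : ‖(d : EuclideanSpace ℝ (Fin n))‖ < ε := by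
        have h3 := congrArg norm h1
        rw [norm_neg, norm_smul, Real.norm_of_nonneg (by linarith)] at h3
        have := hτ x
        nlinarith [norm_nonneg (τ x), norm_nonneg (d : EuclideanSpace ℝ (Fin n))]
      have h4 : x ∈ ⋃ y ∈ t, C y := by rw [ht]; trivial
      obtain ⟨y, hy, hxy⟩ := Set.mem_iUnion₂.1 h4
      obtain ⟨i, hi⟩ := hCe y x hxy d hd (h2.le.trans (hε y hy))
      refine hτe ⟨⟨y, hy⟩, i⟩ x ?_
      change τ x + e y i x = 0
      rw [hi]
      have h5 : (1 - ‖(d : EuclideanSpace ℝ (Fin n))‖) ≠ 0 := by linarith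
      have h6 : (1 - ‖(d : EuclideanSpace ℝ (Fin n))‖)⁻¹ • (d : EuclideanSpace ℝ (Fin n)) =
          - τ x := by
        rw [inv_smul_eq_iff₀ h5, smul_neg]
        exact h1
      rw [h6, add_neg_cancel])
  refine ⟨f1, ContinuousMap.Homotopic.trans ?_ hf1⟩
  refine ⟨⟨⟨fun p => Φ (τ' p, f p.2), ?_⟩, ?_, ?_⟩⟩
  · exact hΦ.comp (hτ'.prodMk (f.continuous.comp continuous_snd))
  · intro x
    have : τ' (0, x) = ctr n := Subtype.ext (by simp [τ', ctr])
    show Φ (τ' (0, x), f x) = f x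
    rw [this]
    exact hΦ0 _ pushG_ctr _
  · intro x
    rfl

end

end

section
section
variable (X : Flow)

theorem compress_aux (k j : ℕ) (g : C(diskBoundary k, (sk X (k + j)).Path)) :
    ∃ a1 : C(diskBoundary k, (sk X k).Path),
      ((resIncl X (k + j)).pathMap.comp g).Homotopic ((resIncl X k).pathMap.comp a1) := by
  induction j with
  | zero => exact ⟨g, ContinuousMap.Homotopic.refl _⟩
  | succ j ih =>
    obtain ⟨g', hg'⟩ := step_homotopic (skAtt X (k + j)) (thin_sphere k (k + j) (Nat.le_add_right _ _))
      (g : C(diskBoundary k, (Attach (skAtt X (k + j))).Path))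
    obtain ⟨a1, ha1⟩ := ih g'
    refine ⟨a1, ContinuousMap.Homotopic.trans ?_ ha1⟩
    have h1 : ((resIncl X (k + (j + 1))).pathMap.comp g).Homotopic
        ((resIncl X (k + (j + 1))).pathMap.comp ((skι X (k + j)).pathMap.comp g')) :=
      ContinuousMap.Homotopic.comp (ContinuousMap.Homotopic.refl _) hg'
    have h2 : (resIncl X (k + (j + 1))).pathMap.comp ((skι X (k + j)).pathMap.comp g') =
        (resIncl X (k + j)).pathMap.comp g' :=
      ContinuousMap.ext fun x => FlowHom.congrP (resIncl_ι X (k + j)) (g' x)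
    rwa [h2] at h1

theorem compress (k : ℕ) (a : C(diskBoundary k, (Res X).Path)) :
    ∃ a1 : C(diskBoundary k, (sk X k).Path),
      a.Homotopic ((resIncl X k).pathMap.comp a1) := by
  obtain ⟨n, g, hg⟩ := finite_stage_lift X a
  obtain ⟨a1, h⟩ := compress_aux X k n ((skle X (Nat.le_add_left n k)).pathMap.comp g)
  refine ⟨a1, ?_⟩
  have : (resIncl X (k + n)).pathMap.comp ((skle X (Nat.le_add_left n k)).pathMap.comp g) = a :=
    ContinuousMap.ext fun x =>
      (FlowHom.congrP (skle_of X _ (resIncl_ι X) (Nat.le_add_left n k)) (g x)).trans (hg x)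
  rwa [this] at h

instance preconn_disk (k : ℕ) : PreconnectedSpace (closedDisk k) :=
  isPreconnected_iff_preconnectedSpace.1 (convex_closedBall _ _).isPreconnected

theorem const_of_disk (k : ℕ) {T : Type} (q : X.Path → T) (hq : ∀ b, IsOpen (q ⁻¹' {b}))
    (b : C(closedDisk k, X.Path)) (y y' : closedDisk k) : q (b y) = q (b y') := by
  have : IsLocallyConstant fun y => q (b y) :=
    (IsLocallyConstant.iff_isOpen_fiber).2 fun c => (hq c).preimage b.continuous
  exact this.apply_eq_of_preconnectedSpace _ _

theorem cell_lemma (k : ℕ) (a1 : C(diskBoundary k, (sk X k).Path)) (b1 : C(closedDisk k, X.Path))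
    (h : ∀ z, b1 (diskBoundaryInclusion k z) = (skp X k).toFunP (a1 z)) :
    ∃ g1 : C(closedDisk k, (Res X).Path),
      (∀ z, g1 (diskBoundaryInclusion k z) = (resIncl X k).toFunP (a1 z)) ∧
      ∀ y, (resp X).toFunP (g1 y) = b1 y := by
  obtain ⟨α, hα⟩ := (skp_bij X k).2 (X.s (b1 (ctr k)))
  obtain ⟨β, hβ⟩ := (skp_bij X k).2 (X.t (b1 (ctr k)))
  have hs : ∀ z, (sk X k).s (a1 z) = α := by
    intro z
    apply (skp_bij X k).1
    rw [hα, ← (skp X k).s_map, ← h]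
    exact const_of_disk X k X.s X.isOpen_preimage_s b1 _ _
  have ht : ∀ z, (sk X k).t (a1 z) = β := by
    intro z
    apply (skp_bij X k).1
    rw [hβ, ← (skp X k).t_map, ← h]
    exact const_of_disk X k X.t X.isOpen_preimage_t b1 _ _
  let A : FlowHom (Glob (diskBoundary k)) (sk X k) := globHom α β a1 hs ht
  let B : FlowHom (Glob (closedDisk k)) X :=
    globHom (X.s (b1 (ctr k))) (X.t (b1 (ctr k))) b1
      (fun c => const_of_disk X k X.s X.isOpen_preimage_s b1 _ _)
      (fun c => const_of_disk X k X.t X.isOpen_preimage_t b1 _ _)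
  let c : skCells X k := ⟨(A, B), globHom_ext hα.symm hβ.symm h⟩
  refine ⟨(resIncl X (k + 1)).pathMap.comp ((skCell X k c).pathMap), ?_, ?_⟩
  · intro z
    have h1 : (skCell X k c).toFunP (diskBoundaryInclusion k z) = (skι X k).toFunP (a1 z) :=
      (att_comm_apply (skAtt X k) c z)
    exact (congrArg (resIncl X (k + 1)).toFunP h1).trans (FlowHom.congrP (resIncl_ι X k) (a1 z))
  · intro y
    exact (FlowHom.congrP (resp_incl X (k + 1)) ((skCell X k c).toFunP y)).trans
      (FlowHom.congrP (skp_cell X k c) y)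

end

theorem glue_collar {Z : Type} [TopologicalSpace Z] (k : ℕ) (b : C(closedDisk k, Z))
    (H : C(unitInterval × diskBoundary k, Z)) (h : ∀ z, H (0, z) = b (diskBoundaryInclusion k z)) :
    ∃ E : C(EuclideanSpace ℝ (Fin k), Z), (∀ y : closedDisk k, E y = b y) ∧
      ∀ (z : diskBoundary k) (t : unitInterval),
        E ((1 + (t : ℝ)) • (z : EuclideanSpace ℝ (Fin k))) = H (t, z) := by
  classical
  let pr : EuclideanSpace ℝ (Fin k) → closedDisk k := fun y =>
    ⟨(max 1 ‖y‖)⁻¹ • y, by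
      rw [mem_closedBall_zero_iff, norm_smul, norm_inv, Real.norm_of_nonneg (by positivity),
        inv_mul_le_one₀ (by positivity)]
      exact le_max_right _ _⟩
  have hpr : Continuous pr := by
    refine Continuous.subtype_mk ?_ _
    have h3 : Continuous fun y : EuclideanSpace ℝ (Fin k) => (max 1 ‖y‖)⁻¹ :=
      Continuous.inv₀ (continuous_const.max continuous_norm) fun y =>
        ne_of_gt (lt_max_of_lt_left one_pos)
    exact h3.smul continuous_id
  let nz : ∀ y : EuclideanSpace ℝ (Fin k), y ≠ 0 → diskBoundary k := fun y hy =>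
    ⟨‖y‖⁻¹ • y, by rw [mem_sphere_zero_iff_norm, norm_smul, norm_inv, norm_norm,
      inv_mul_cancel₀ (norm_ne_zero_iff.2 hy)]⟩
  let tt : EuclideanSpace ℝ (Fin k) → unitInterval := fun y =>
    Set.projIcc 0 1 zero_le_one (‖y‖ - 1)
  have htt : Continuous tt := continuous_projIcc.comp (continuous_norm.sub continuous_const)
  let h2 : EuclideanSpace ℝ (Fin k) → Z := fun y =>
    if hy : y = 0 then b (pr y) else H (tt y, nz y hy)
  have hh2 : ContinuousOn h2 {y | 1 ≤ ‖y‖} := by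
    rw [continuousOn_iff_continuous_domRestrict]
    have hne : ∀ y : {y : EuclideanSpace ℝ (Fin k) | 1 ≤ ‖y‖}, (y : EuclideanSpace ℝ (Fin k)) ≠ 0 := by
      rintro ⟨y, hy⟩ h0
      have hy' : 1 ≤ ‖y‖ := hy
      have h0' : y = 0 := h0
      rw [h0', norm_zero] at hy'
      linarith
    have hc : Continuous fun y : {y : EuclideanSpace ℝ (Fin k) | 1 ≤ ‖y‖} => H (tt y, nz y (hne y)) := by
      refine H.continuous.comp ((htt.comp continuous_subtype_val).prodMk (Continuous.subtype_mk ?_ _))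
      have h3 : Continuous fun y : {y : EuclideanSpace ℝ (Fin k) | 1 ≤ ‖y‖} =>
          ‖(y : EuclideanSpace ℝ (Fin k))‖⁻¹ :=
        continuous_subtype_val.norm.inv₀ fun y => norm_ne_zero_iff.2 (hne y)
      exact h3.smul continuous_subtype_val
    refine hc.congr fun y => ?_
    have e0 : h2 (y : EuclideanSpace ℝ (Fin k)) = H (tt y, nz y (hne y)) := dif_neg (hne y)
    exact e0.symm
  have hagree : ∀ y, ‖y‖ = 1 → b (pr y) = h2 y := by
    intro y hy
    have hy0 : y ≠ 0 := fun h0 => by rw [h0, norm_zero] at hy; linarith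
    have e1 : h2 y = H (tt y, nz y hy0) := dif_neg hy0
    have e2 : tt y = 0 := by
      simp only [tt, hy, sub_self]
      exact Set.projIcc_left _
    rw [e1, e2, h]
    congr 1
    refine Subtype.ext ?_
    simp [pr, nz, hy, diskBoundaryInclusion]
  let E : C(EuclideanSpace ℝ (Fin k), Z) :=
    ⟨fun y => if ‖y‖ ≤ 1 then b (pr y) else h2 y,
      continuous_if_le continuous_norm continuous_const (b.continuous.comp hpr).continuousOn hh2
        hagree⟩
  refine ⟨E, ?_, ?_⟩
  · intro y
    have hy : ‖(y : EuclideanSpace ℝ (Fin k))‖ ≤ 1 := mem_closedBall_zero_iff.1 y.2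
    refine (if_pos hy).trans ?_
    congr 1
    refine Subtype.ext ?_
    simp [pr, max_eq_left hy]
  · intro z t
    have hz : ‖(z : EuclideanSpace ℝ (Fin k))‖ = 1 := mem_sphere_zero_iff_norm.1 z.2
    have ht0 := t.2.1
    have hn : ‖(1 + (t : ℝ)) • (z : EuclideanSpace ℝ (Fin k))‖ = 1 + t := by
      rw [norm_smul, hz, mul_one, Real.norm_of_nonneg (by linarith)]
    generalize hy : (1 + (t : ℝ)) • (z : EuclideanSpace ℝ (Fin k)) = y at hn
    have hy0 : y ≠ 0 := fun h0 => by rw [h0, norm_zero] at hn; linarith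
    have e1 : h2 y = H (tt y, nz y hy0) := dif_neg hy0
    have e2 : tt y = t := by
      have : ‖y‖ - 1 = t := by rw [hn]; ring
      simp only [tt, this]
      exact Set.projIcc_val _ t
    have e3 : nz y hy0 = z := by
      refine Subtype.ext ?_
      simp only [nz]
      rw [hn, ← hy, inv_smul_smul₀ (by linarith)]
    have e4 : h2 y = H (t, z) := by rw [e1, e2, e3]
    by_cases h1 : ‖y‖ ≤ 1
    · exact ((if_pos h1).trans (hagree y (le_antisymm h1 (by linarith)))).trans e4
    · exact (if_neg h1).trans e4

theorem hlp_disk (X : Flow) (k : ℕ) (a : C(diskBoundary k, (Res X).Path)) (b : C(closedDisk k, X.Path))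
    (hab : ∀ z, b (diskBoundaryInclusion k z) = (resp X).toFunP (a z)) :
    ∃ g : C(closedDisk k, (Res X).Path), (∀ z, g (diskBoundaryInclusion k z) = a z) ∧
      ∃ F : C(unitInterval × closedDisk k, X.Path),
        (∀ y, F (0, y) = (resp X).toFunP (g y)) ∧ (∀ y, F (1, y) = b y) ∧
        ∀ u z, F (u, diskBoundaryInclusion k z) = (resp X).toFunP (a z) := by
  obtain ⟨a1, ⟨H⟩⟩ := compress X k a
  have H0 : ∀ z, H (0, z) = a z := H.apply_zero
  have H1 : ∀ z, H (1, z) = (resIncl X k).toFunP (a1 z) := H.apply_one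
  obtain ⟨E, hE0, hE1⟩ := glue_collar k b ((resp X).pathMap.comp H.toContinuousMap)
    (fun z => (congrArg (resp X).toFunP (H0 z)).trans (hab z).symm)
  have hE1' : ∀ (z : diskBoundary k) (t : unitInterval),
        E ((1 + (t : ℝ)) • (z : EuclideanSpace ℝ (Fin k))) = (resp X).toFunP (H (t, z)) := hE1
  let b1 : C(closedDisk k, X.Path) := ⟨fun y => E ((2 : ℝ) • (y : EuclideanSpace ℝ (Fin k))),
    E.continuous.comp (continuous_subtype_val.const_smul (2 : ℝ))⟩
  have hb1 : ∀ z, b1 (diskBoundaryInclusion k z) = (skp X k).toFunP (a1 z) := by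
    intro z
    have h1 := hE1' z 1
    rw [H1] at h1
    have e : (1 + ((1 : unitInterval) : ℝ)) = 2 := by norm_num
    rw [e] at h1
    exact h1.trans (FlowHom.congrP (resp_incl X k) (a1 z))
  obtain ⟨g1, hg1, hpg1⟩ := cell_lemma X k a1 b1 hb1
  obtain ⟨G, hG0, hG1⟩ := glue_collar k g1 (H.toContinuousMap.comp
    (ContinuousMap.prodMk ⟨fun p => unitInterval.symm p.1, by fun_prop⟩ ⟨Prod.snd, continuous_snd⟩))
    (fun z => by
      refine Eq.trans ?_ ((H1 z).trans (hg1 z).symm)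
      show H (unitInterval.symm 0, z) = H (1, z)
      rw [unitInterval.symm_zero])
  have hG1' : ∀ (z : diskBoundary k) (t : unitInterval),
        G ((1 + (t : ℝ)) • (z : EuclideanSpace ℝ (Fin k))) = H (unitInterval.symm t, z) := hG1
  let R : EuclideanSpace ℝ (Fin k) → EuclideanSpace ℝ (Fin k) := fun y =>
    (3 * (max 1 ‖y‖)⁻¹ - 1) • y
  have hR : Continuous R := by
    have h3 : Continuous fun y : EuclideanSpace ℝ (Fin k) => 3 * (max 1 ‖y‖)⁻¹ - 1 :=
      (continuous_const.mul (Continuous.inv₀ (continuous_const.max continuous_norm) fun y =>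
        ne_of_gt (lt_max_of_lt_left one_pos))).sub continuous_const
    exact h3.smul continuous_id
  have hpG : ∀ y, ‖y‖ ≤ 2 → (resp X).toFunP (G y) = E (R y) := by
    intro y hy2
    by_cases hy : ‖y‖ ≤ 1
    · have e1 : G y = g1 ⟨y, mem_closedBall_zero_iff.2 hy⟩ := hG0 ⟨y, mem_closedBall_zero_iff.2 hy⟩
      rw [e1, hpg1]
      show E ((2 : ℝ) • y) = E (R y)
      congr 1
      simp only [R, max_eq_left hy]
      norm_num
    · push Not at hy
      have hy0 : ‖y‖ ≠ 0 := by linarith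
      let z : diskBoundary k := ⟨‖y‖⁻¹ • y, by
        rw [mem_sphere_zero_iff_norm, norm_smul, norm_inv, norm_norm, inv_mul_cancel₀ hy0]⟩
      let t : unitInterval := ⟨‖y‖ - 1, by constructor <;> linarith⟩
      have e1 : (1 + (t : ℝ)) • (z : EuclideanSpace ℝ (Fin k)) = y := by
        simp only [t, z]
        rw [add_sub_cancel, smul_inv_smul₀ hy0]
      have e2 : (1 + ((unitInterval.symm t : unitInterval) : ℝ)) • (z : EuclideanSpace ℝ (Fin k)) =
          R y := by
        simp only [t, z, R, unitInterval.coe_symm_eq, max_eq_right hy.le, smul_smul]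
        congr 1
        field_simp
        ring
      have e3 := hG1' z t
      rw [e1] at e3
      have e4 := hE1' z (unitInterval.symm t)
      rw [e2] at e4
      rw [e3, e4]
  let g : C(closedDisk k, (Res X).Path) := ⟨fun y => G ((2 : ℝ) • (y : EuclideanSpace ℝ (Fin k))),
    G.continuous.comp (continuous_subtype_val.const_smul (2 : ℝ))⟩
  have hval : ∀ y : closedDisk k, ‖(2 : ℝ) • (y : EuclideanSpace ℝ (Fin k))‖ ≤ 2 := by
    intro y
    have hy : ‖(y : EuclideanSpace ℝ (Fin k))‖ ≤ 1 := mem_closedBall_zero_iff.1 y.2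
    rw [norm_smul, Real.norm_of_nonneg (by norm_num)]
    linarith
  refine ⟨g, ?_, ⟨fun p => E ((1 - (p.1 : ℝ)) • R ((2 : ℝ) • (p.2 : EuclideanSpace ℝ (Fin k))) +
    (p.1 : ℝ) • (p.2 : EuclideanSpace ℝ (Fin k))), ?_⟩, ?_, ?_, ?_⟩
  · intro z
    have h1 := hG1' z 1
    rw [unitInterval.symm_one, H0] at h1
    have e : (1 + ((1 : unitInterval) : ℝ)) = 2 := by norm_num
    rw [e] at h1
    exact h1
  · have c1 : Continuous fun p : unitInterval × closedDisk k => (p.1 : ℝ) :=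
      continuous_subtype_val.comp continuous_fst
    have c2 : Continuous fun p : unitInterval × closedDisk k => (p.2 : EuclideanSpace ℝ (Fin k)) :=
      continuous_subtype_val.comp continuous_snd
    exact E.continuous.comp (((continuous_const.sub c1).smul (hR.comp (c2.const_smul (2 : ℝ)))).add
      (c1.smul c2))
  · intro y
    show E _ = (resp X).toFunP (G _)
    rw [hpG _ (hval y)]
    simp
  · intro y
    show E _ = b y
    rw [← hE0 y]
    simp
  · intro u z
    have hz : ‖(z : EuclideanSpace ℝ (Fin k))‖ = 1 := mem_sphere_zero_iff_norm.1 z.2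
    rw [← hab z, ← hE0]
    show E _ = E _
    congr 1
    have e1 : R ((2 : ℝ) • (diskBoundaryInclusion k z : EuclideanSpace ℝ (Fin k))) =
        (diskBoundaryInclusion k z : EuclideanSpace ℝ (Fin k)) := by
      have hn : ‖(2 : ℝ) • (diskBoundaryInclusion k z : EuclideanSpace ℝ (Fin k))‖ = 2 := by
        rw [norm_smul]
        show ‖(2 : ℝ)‖ * ‖(z : EuclideanSpace ℝ (Fin k))‖ = 2
        rw [hz]; norm_num
      simp only [R, hn, smul_smul]
      norm_num
    show (1 - (u : ℝ)) • R ((2 : ℝ) • (diskBoundaryInclusion k z : EuclideanSpace ℝ (Fin k))) +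
      (u : ℝ) • (diskBoundaryInclusion k z : EuclideanSpace ℝ (Fin k)) = _
    rw [e1, ← add_smul]
    simp

end

section
theorem cube_homeo (k : ℕ) : ∃ φ : (Fin k → unitInterval) ≃ₜ closedDisk k,
    ∀ y, y ∈ Cube.boundary (Fin k) ↔ ‖(φ y : EuclideanSpace ℝ (Fin k))‖ = 1 := by
  let L : EuclideanSpace ℝ (Fin k) ≃L[ℝ] (Fin k → ℝ) := EuclideanSpace.equiv (Fin k) ℝ
  let B : Set (Fin k → ℝ) := Set.univ.pi fun _ => Set.Icc (0 : ℝ) 1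
  let s : Set (EuclideanSpace ℝ (Fin k)) := L ⁻¹' B
  have hIntr : interior s = L ⁻¹' (Set.univ.pi fun _ => Set.Ioo (0 : ℝ) 1) := by
    rw [show s = L.toHomeomorph ⁻¹' B from rfl, ← L.toHomeomorph.preimage_interior,
      interior_pi_set Set.finite_univ]
    simp only [interior_Icc]
    rfl
  have hcl : IsClosed s := (isClosed_set_pi fun _ _ => isClosed_Icc).preimage L.continuous
  have hcomp : IsCompact s := by
    have : IsCompact B := isCompact_univ_pi fun _ => isCompact_Icc
    exact L.toHomeomorph.isCompact_preimage.2 this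
  have hconv : Convex ℝ s :=
    (convex_pi fun _ _ => convex_Icc 0 1).linear_preimage (L : EuclideanSpace ℝ (Fin k) →ₗ[ℝ] (Fin k → ℝ))
  have hne : (interior s).Nonempty := by
    rw [hIntr]
    refine ⟨L.symm fun _ => 1 / 2, ?_⟩
    intro i _
    rw [L.apply_symm_apply]
    norm_num
  obtain ⟨h, h1, h2, h3⟩ :=
    exists_homeomorph_image_interior_closure_frontier_eq_unitBall hconv hne hcomp.isBounded
  rw [hcl.closure_eq] at h2
  have hmem : ∀ y : Fin k → unitInterval, L.symm (fun i => (y i : ℝ)) ∈ s := by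
    intro y i _
    rw [L.apply_symm_apply]
    exact (y i).2
  let f : (Fin k → unitInterval) → closedDisk k := fun y =>
    ⟨h (L.symm fun i => (y i : ℝ)), h2 ▸ Set.mem_image_of_mem _ (hmem y)⟩
  have hf : Continuous f := by
    refine Continuous.subtype_mk (h.continuous.comp (L.symm.continuous.comp ?_)) _
    exact continuous_pi fun i => continuous_subtype_val.comp (continuous_apply i)
  have hbij : Function.Bijective f := by
    constructor
    · intro y y' hyy
      have h4 := L.symm.injective (h.injective (congrArg Subtype.val hyy))
      funext i
      exact Subtype.ext (congrFun h4 i)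
    · rintro ⟨y, hy⟩
      rw [← h2] at hy
      obtain ⟨x, hx, rfl⟩ := hy
      refine ⟨fun i => ⟨L x i, hx i trivial⟩, Subtype.ext ?_⟩
      exact congrArg h (L.symm_apply_apply x)
  refine ⟨hf.homeoOfEquivCompactToT2 (f := Equiv.ofBijective f hbij), fun y => ?_⟩
  show y ∈ Cube.boundary (Fin k) ↔ ‖h (L.symm fun i => (y i : ℝ))‖ = 1
  have hle : ‖h (L.symm fun i => (y i : ℝ))‖ ≤ 1 := mem_closedBall_zero_iff.1 (f y).2
  have h5 : (L.symm fun i => (y i : ℝ)) ∈ interior s ↔ ‖h (L.symm fun i => (y i : ℝ))‖ < 1 := by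
    rw [← mem_ball_zero_iff, ← h1, h.injective.mem_set_image]
  have h6 : (L.symm fun i => (y i : ℝ)) ∈ interior s ↔ ¬ y ∈ Cube.boundary (Fin k) := by
    rw [hIntr, Set.mem_preimage, L.apply_symm_apply]
    simp only [Cube.boundary, Set.mem_pi, Set.mem_univ, true_implies, Set.mem_Ioo,
      Set.mem_ofPred_eq, not_exists, not_or]
    refine forall_congr' fun i => and_congr ?_ ?_
    · exact unitInterval.pos_iff_ne_zero
    · exact unitInterval.lt_one_iff_ne_one
  constructor
  · intro hy
    by_contra hn
    exact h6.1 (h5.2 (lt_of_le_of_ne hle hn)) hy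
  · intro hy
    by_contra hn
    exact absurd (h5.1 (h6.2 hn)) (by rw [hy]; exact lt_irrefl _)

theorem hlp_cube (X : Flow) (k : ℕ) (a : C(Cube.boundary (Fin k), (Res X).Path))
    (b : C(Fin k → unitInterval, X.Path))
    (hab : ∀ z : Cube.boundary (Fin k), b z = (resp X).toFunP (a z)) :
    ∃ g : C(Fin k → unitInterval, (Res X).Path), (∀ z : Cube.boundary (Fin k), g z = a z) ∧
      ((resp X).pathMap.comp g).HomotopicRel b (Cube.boundary (Fin k)) := by
  obtain ⟨φ, hφ⟩ := cube_homeo k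
  have hm : ∀ z : diskBoundary k, φ.symm (diskBoundaryInclusion k z) ∈ Cube.boundary (Fin k) := by
    intro z
    rw [hφ, φ.apply_symm_apply]
    exact mem_sphere_zero_iff_norm.1 z.2
  let a' : C(diskBoundary k, (Res X).Path) := ⟨fun z => a ⟨_, hm z⟩,
    a.continuous.comp (Continuous.subtype_mk
      (φ.symm.continuous.comp (diskBoundaryInclusion k).continuous) _)⟩
  let b' : C(closedDisk k, X.Path) := ⟨fun y => b (φ.symm y), b.continuous.comp φ.symm.continuous⟩
  obtain ⟨g, hg, F, hF0, hF1, hFz⟩ := hlp_disk X k a' b' (fun z => hab ⟨_, hm z⟩)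
  have hz : ∀ y ∈ Cube.boundary (Fin k), ∃ z : diskBoundary k, diskBoundaryInclusion k z = φ y := by
    intro y hy
    exact ⟨⟨(φ y : EuclideanSpace ℝ (Fin k)), mem_sphere_zero_iff_norm.2 ((hφ y).1 hy)⟩, rfl⟩
  have ha' : ∀ z (y) (hy : y ∈ Cube.boundary (Fin k)), diskBoundaryInclusion k z = φ y →
      a' z = a ⟨y, hy⟩ := by
    intro z y hy h
    refine congrArg a (Subtype.ext ?_)
    exact (congrArg φ.symm h).trans (φ.symm_apply_apply y)
  refine ⟨⟨fun y => g (φ y), g.continuous.comp φ.continuous⟩, ?_,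
    ⟨⟨⟨⟨fun p => F (p.1, φ p.2), ?_⟩, ?_, ?_⟩, ?_⟩⟩⟩
  · rintro ⟨y, hy⟩
    obtain ⟨z, h⟩ := hz y hy
    refine Eq.trans ?_ (ha' z y hy h)
    exact (congrArg g h.symm).trans (hg z)
  · exact F.continuous.comp (continuous_fst.prodMk (φ.continuous.comp continuous_snd))
  · intro y
    exact hF0 _
  · intro y
    exact (hF1 _).trans (congrArg b (φ.symm_apply_apply y))
  · intro u y hy
    obtain ⟨z, h⟩ := hz y hy
    show F (u, φ y) = (resp X).toFunP (g (φ y))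
    rw [← h, hFz, hg]

end

section
theorem rel_lift (X : Flow) (n : ℕ) (f0 f1 : C(Fin n → unitInterval, (Res X).Path))
    (hf : ∀ y ∈ Cube.boundary (Fin n), f0 y = f1 y)
    (hH : ((resp X).pathMap.comp f0).HomotopicRel ((resp X).pathMap.comp f1)
      (Cube.boundary (Fin n))) :
    f0.HomotopicRel f1 (Cube.boundary (Fin n)) := by
  classical
  obtain ⟨H⟩ := hH
  have H0 : ∀ y, H (0, y) = (resp X).toFunP (f0 y) := H.apply_zero
  have H1 : ∀ y, H (1, y) = (resp X).toFunP (f1 y) := H.apply_one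
  have Hb : ∀ u, ∀ y ∈ Cube.boundary (Fin n), H (u, y) = (resp X).toFunP (f0 y) :=
    fun u y hy => H.eq_fst u hy
  have htl : Continuous fun y : Fin (n + 1) → unitInterval => (Fin.tail y : Fin n → unitInterval) :=
    continuous_pi fun i => continuous_apply i.succ
  have hbd : ∀ y ∈ Cube.boundary (Fin (n + 1)), y 0 = 0 ∨ y 0 = 1 ∨
      (Fin.tail y : Fin n → unitInterval) ∈ Cube.boundary (Fin n) := by
    rintro y ⟨i, hi⟩
    induction i using Fin.cases with
    | zero => rcases hi with hi | hi <;> simp [hi]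
    | succ i => exact Or.inr (Or.inr ⟨i, hi⟩)
  let a : C(Cube.boundary (Fin (n + 1)), (Res X).Path) :=
    ⟨fun y => if ((y.1 0 : unitInterval) : ℝ) ≤ 1 / 2 then f0 (Fin.tail y.1) else f1 (Fin.tail y.1), by
      refine continuous_if_le ?_ continuous_const ?_ ?_ ?_
      · exact continuous_subtype_val.comp ((continuous_apply 0).comp continuous_subtype_val)
      · exact (f0.continuous.comp (htl.comp continuous_subtype_val)).continuousOn
      · exact (f1.continuous.comp (htl.comp continuous_subtype_val)).continuousOn
      · rintro ⟨y, hy⟩ h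
        apply hf
        have h' : ((y 0 : unitInterval) : ℝ) = 1 / 2 := h
        rcases hbd y hy with h0 | h0 | h0
        · rw [h0] at h'; norm_num at h'
        · rw [h0] at h'; norm_num at h'
        · exact h0⟩
  let b : C(Fin (n + 1) → unitInterval, X.Path) :=
    ⟨fun y => H (y 0, Fin.tail y), H.continuous.comp ((continuous_apply 0).prodMk htl)⟩
  have a0 : ∀ (y) (hy : y ∈ Cube.boundary (Fin (n + 1))), ((y 0 : unitInterval) : ℝ) ≤ 1 / 2 →
      a ⟨y, hy⟩ = f0 (Fin.tail y) := fun y hy h => if_pos h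
  have a1 : ∀ (y) (hy : y ∈ Cube.boundary (Fin (n + 1))), ¬ ((y 0 : unitInterval) : ℝ) ≤ 1 / 2 →
      a ⟨y, hy⟩ = f1 (Fin.tail y) := fun y hy h => if_neg h
  obtain ⟨g, hg, -⟩ := hlp_cube X (n + 1) a b (by
    rintro ⟨y, hy⟩
    show H (y 0, Fin.tail y) = _
    by_cases h : ((y 0 : unitInterval) : ℝ) ≤ 1 / 2
    · rw [a0 y hy h]
      rcases hbd y hy with h0 | h0 | h0
      · rw [h0, H0]
      · rw [h0] at h; norm_num at h
      · exact Hb _ _ h0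
    · rw [a1 y hy h]
      rcases hbd y hy with h0 | h0 | h0
      · rw [h0] at h; norm_num at h
      · rw [h0, H1]
      · rw [← hf _ h0]
        exact Hb _ _ h0)
  have hcons : Continuous fun p : unitInterval × (Fin n → unitInterval) =>
      (Fin.cons p.1 p.2 : Fin (n + 1) → unitInterval) := by
    refine continuous_pi fun i => ?_
    induction i using Fin.cases with
    | zero => exact continuous_fst
    | succ i => exact (continuous_apply i).comp continuous_snd
  refine ⟨⟨⟨⟨fun p => g (Fin.cons p.1 p.2), g.continuous.comp hcons⟩, ?_, ?_⟩, ?_⟩⟩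
  · intro y
    have hy : (Fin.cons 0 y : Fin (n + 1) → unitInterval) ∈ Cube.boundary (Fin (n + 1)) :=
      ⟨0, Or.inl rfl⟩
    refine (hg ⟨_, hy⟩).trans ((a0 _ hy ?_).trans ?_)
    · simp
    · rw [Fin.tail_cons]
  · intro y
    have hy : (Fin.cons 1 y : Fin (n + 1) → unitInterval) ∈ Cube.boundary (Fin (n + 1)) :=
      ⟨0, Or.inr rfl⟩
    refine (hg ⟨_, hy⟩).trans ((a1 _ hy ?_).trans ?_)
    · simp; norm_num
    · rw [Fin.tail_cons]
  · intro u y hy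
    have hy' : (Fin.cons u y : Fin (n + 1) → unitInterval) ∈ Cube.boundary (Fin (n + 1)) := by
      obtain ⟨i, hi⟩ := hy
      exact ⟨i.succ, hi⟩
    refine (hg ⟨_, hy'⟩).trans ?_
    by_cases h : (((Fin.cons u y : Fin (n + 1) → unitInterval) 0 : unitInterval) : ℝ) ≤ 1 / 2
    · exact (a0 _ hy' h).trans (by rw [Fin.tail_cons])
    · exact (a1 _ hy' h).trans (by rw [Fin.tail_cons, hf y hy])

theorem res_weak (X : Flow) : IsWeakHomotopyEquiv (resp X).pathMap := by
  refine ⟨⟨?_, ?_⟩, fun x n => ⟨?_, ?_⟩⟩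
  · intro q q'
    induction q using Quotient.ind with
    | _ x =>
    induction q' using Quotient.ind with
    | _ x' =>
    intro h
    obtain ⟨γ⟩ : Joined ((resp X).pathMap x) ((resp X).pathMap x') := Quotient.exact h
    obtain ⟨F⟩ := rel_lift X 0 (ContinuousMap.const _ x) (ContinuousMap.const _ x')
      (fun y hy => hy.choose.elim0) ⟨⟨⟨⟨fun p => γ p.1, γ.continuous.comp continuous_fst⟩,
        fun y => γ.source, fun y => γ.target⟩, fun u y hy => hy.choose.elim0⟩⟩
    refine Quotient.sound ⟨⟨⟨fun u => F (u, fun i => i.elim0), ?_⟩, ?_, ?_⟩⟩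
    · exact F.continuous.comp (continuous_id.prodMk continuous_const)
    · exact F.apply_zero _
    · exact F.apply_one _
  · intro q
    induction q using Quotient.ind with
    | _ y =>
    haveI : IsEmpty (Cube.boundary (Fin 0)) := ⟨fun z => z.2.choose.elim0⟩
    obtain ⟨g, -, ⟨F⟩⟩ := hlp_cube X 0 ⟨fun z => isEmptyElim z, continuous_of_const fun z => isEmptyElim z⟩
      (ContinuousMap.const _ y) (fun z => isEmptyElim z)
    refine ⟨Quotient.mk _ (g fun i => i.elim0), Quotient.sound
      ⟨⟨⟨fun u => F (u, fun i => i.elim0), ?_⟩, ?_, ?_⟩⟩⟩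
    · exact F.continuous.comp (continuous_id.prodMk continuous_const)
    · exact F.apply_zero _
    · exact F.apply_one _
  · intro q q'
    induction q using Quotient.ind with
    | _ l =>
    induction q' using Quotient.ind with
    | _ l' =>
    intro h
    have h' : GenLoop.Homotopic (GenLoop.push (resp X).pathMap l) (GenLoop.push (resp X).pathMap l') :=
      Quotient.exact h
    refine Quotient.sound ?_
    exact rel_lift X n l.1 l'.1 (fun y hy => (l.2 y hy).trans (l'.2 y hy).symm) h'
  · intro q
    induction q using Quotient.ind with
    | _ l =>
    obtain ⟨g, hg, hF⟩ := hlp_cube X n (ContinuousMap.const _ x) l.1 (fun z => l.2 z z.2)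
    exact ⟨Quotient.mk _ ⟨g, fun y hy => hg ⟨y, hy⟩⟩, Quotient.sound hF⟩

theorem main_aux (X : Flow) :
    ∃ (X' : Flow) (_ : SCofibrant X') (f : FlowHom X' X), IsWeakSHomotopyEquiv f :=
  ⟨Res X, res_sCofibrant X, resp X, resp_bij X, res_weak X⟩

end

/-- every flow is weakly S-homotopy equivalent to an S-cofibrant flow. -/
theorem exists_sCofibrant_weakSHomotopyEquiv (X : Flow) :
    ∃ (X' : Flow) (_ : SCofibrant X') (f : FlowHom X' X), IsWeakSHomotopyEquiv f := by
  exact main_aux X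

end Gaucher
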